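/- arXiv:0704.2411 — 7 statements merged into one kernel-verified Lean document; each statement's English description precedes it below -/
import Mathlib

section
/- Let K be an infinite field, Q a strongly connected quiver with m(Q) = m, and a = a_1⋯a_s a closed path in Q with a_1,…,a_s ∈ Q_1. If the invariant q = det(X_{a_s}⋯X_{a_1}) ∈ Inv(Q,(2,…,2)) is indecomposable, then deg(q) ≤ 2m. -/
open Classical BigOperators

/-- A quiver (finite oriented graph data): a type of vertices, a type of arrows,
and source (tail `a''`) and target (head `a'`) maps. -/
structure QuiverData where
  V : Type
  A : Type
  src : A → V
  tgt : A → V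

namespace QuiverData

variable (Q : QuiverData)

/-- `Q.IsPathFrom u v l` : the list of arrows `l` is a (possibly empty) path
from `u` to `v`, i.e. `l = [a₁, …, a_s]` with `a₁'' = u`, `aᵢ' = a_{i+1}''`, `a_s' = v`. -/
def IsPathFrom : Q.V → Q.V → List Q.A → Prop
  | u, v, [] => u = v
  | u, v, a :: l => Q.src a = u ∧ IsPathFrom (Q.tgt a) v l

/-- A (non-empty) closed path in the vertex `v`. -/
def IsClosedAt (v : Q.V) (l : List Q.A) : Prop :=
  l ≠ [] ∧ Q.IsPathFrom v v l

/-- A (non-empty) closed path. -/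
def IsClosed (l : List Q.A) : Prop := ∃ v, Q.IsClosedAt v l

/-- `deg_w(l)`: the degree of the closed path `l` in the vertex `w`,
i.e. the number of `i` with `aᵢ' = w`. -/
noncomputable def vdeg (l : List Q.A) (w : Q.V) : ℕ :=
  Nat.card {i : Fin l.length // Q.tgt (l.get i) = w}

/-- `deg_b(l)`: the number of occurrences of the arrow `b` in the path `l`. -/
noncomputable def adeg (l : List Q.A) (b : Q.A) : ℕ :=
  Nat.card {i : Fin l.length // l.get i = b}

/-- The number of occurrences in `l` of arrows from the set `S`. -/
noncomputable def sdeg (l : List Q.A) (S : Set Q.A) : ℕ :=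
  Nat.card {i : Fin l.length // l.get i ∈ S}

/-- A primitive closed path in `v`: a closed path without self-intersections,
i.e. `deg_w = 1` for every vertex `w` of the path. -/
def IsPrimitiveAt (v : Q.V) (l : List Q.A) : Prop :=
  Q.IsClosedAt v l ∧ ∀ a ∈ l, Q.vdeg l (Q.tgt a) = 1

/-- A primitive closed path. -/
def IsPrimitive (l : List Q.A) : Prop := ∃ v, Q.IsPrimitiveAt v l

/-- `m(Q) = m` : `m` is the maximal degree of primitive closed paths in `Q`. -/
def MaxPrimDeg (m : ℕ) : Prop :=
  (∃ l, Q.IsPrimitive l ∧ l.length = m) ∧ ∀ l, Q.IsPrimitive l → l.length ≤ m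

/-- `Q` is strongly connected: there is a closed path containing all vertices;
a quiver with one vertex and no arrows is also strongly connected. -/
def StronglyConnected : Prop :=
  (∃ v l, Q.IsClosedAt v l ∧ ∀ w, ∃ a ∈ l, Q.tgt a = w) ∨
    (Subsingleton Q.V ∧ IsEmpty Q.A)

/-- Formal negation on the set (closed paths with a formal sign) ∪ {0};
`none` is the symbol `0`, and `some (e, l)` is `(-1)^e·l`. -/
def negO : Option (Bool × List Q.A) → Option (Bool × List Q.A)
  | none => none
  | some (e, l) => some (!e, l)

/-- The equivalence `≡` on the set of closed paths of `Q`, enlarged by an additional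
symbol `0` (represented by `none`) and formal signs (`some (e, l)` is `(-1)^e·l`).
The parameter `c2` is the proposition "the characteristic of the ground field is 2"
(so that the formal sign `(-1)^σ` is trivial exactly when `c2` holds).
It is the smallest equivalence, compatible with formal negation, such that for paths
`a`, `b` with `ab` a closed path and incident closed paths `a₁, a₂, …`:
(1) `ab ≡ ba`; (2) `a_{σ(1)}⋯a_{σ(t)} ≡ (-1)^σ a₁⋯a_t` for `t ≥ 2` and `σ ∈ S_t`
(generated here by transpositions of adjacent factors);
(3) `a₁²a₂ ≡ 0`; (4) if `c2` then `a₁² ≡ 0`, while if `¬c2` then `a₁a₂a₃a₄ ≡ 0`. -/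
inductive PEquiv (c2 : Prop) : Option (Bool × List Q.A) → Option (Bool × List Q.A) → Prop
  | refl (x) : PEquiv c2 x x
  | symm {x y} : PEquiv c2 x y → PEquiv c2 y x
  | trans {x y z} : PEquiv c2 x y → PEquiv c2 y z → PEquiv c2 x z
  | neg {x y} : PEquiv c2 x y → PEquiv c2 (Q.negO x) (Q.negO y)
  | cyc (u v : Q.V) (a b : List Q.A) (e : Bool) :
      Q.IsPathFrom u v a → Q.IsPathFrom v u b → a ++ b ≠ [] →
      PEquiv c2 (some (e, a ++ b)) (some (e, b ++ a))
  | swap (v : Q.V) (w₁ c d w₂ : List Q.A) (e : Bool) :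
      Q.IsPathFrom v v w₁ → Q.IsClosedAt v c → Q.IsClosedAt v d → Q.IsPathFrom v v w₂ →
      PEquiv c2 (some (e, w₁ ++ c ++ d ++ w₂))
        (some (if c2 then e else !e, w₁ ++ d ++ c ++ w₂))
  | sq_mul (v : Q.V) (c d : List Q.A) (e : Bool) :
      Q.IsClosedAt v c → Q.IsClosedAt v d →
      PEquiv c2 (some (e, c ++ c ++ d)) none
  | sq (v : Q.V) (c : List Q.A) (e : Bool) :
      c2 → Q.IsClosedAt v c → PEquiv c2 (some (e, c ++ c)) none
  | four (v : Q.V) (c₁ c₂ c₃ c₄ : List Q.A) (e : Bool) :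
      ¬c2 → Q.IsClosedAt v c₁ → Q.IsClosedAt v c₂ → Q.IsClosedAt v c₃ → Q.IsClosedAt v c₄ →
      PEquiv c2 (some (e, c₁ ++ c₂ ++ c₃ ++ c₄)) none
  | sign_triv (e : Bool) (l : List Q.A) :
      c2 → PEquiv c2 (some (e, l)) (some (!e, l))

/-- `l₁ ≡ l₂` for closed paths. -/
def PathEquiv (c2 : Prop) (l₁ l₂ : List Q.A) : Prop :=
  Q.PEquiv c2 (some (false, l₁)) (some (false, l₂))

/-- `l ≡ 0`. -/
def EquivZero (c2 : Prop) (l : List Q.A) : Prop :=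
  Q.PEquiv c2 (some (false, l)) none

/-! ### Invariants of quivers for the dimension vector `(2,…,2)` -/

/-- Variables `x_{ij}(a)` of the polynomial ring: for each arrow `a` the entries of the
`2 × 2` generic matrix `X_a`. -/
def Var : Type := Q.A × Fin 2 × Fin 2

variable (K : Type) [Field K]

/-- The substitution describing the base-change action of the group
`∏_{v} GL₂(K)` (given by a family of invertible matrices `g`) on the variables:
`x_{ij}(a)` is sent to the `(i,j)` entry of `g_{a'} X_a g_{a''}⁻¹`. -/
noncomputable def actVar (g : Q.V → Matrix (Fin 2) (Fin 2) K) (p : Q.Var) :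
    MvPolynomial Q.Var K :=
  ∑ k : Fin 2, ∑ l : Fin 2,
    MvPolynomial.C (g (Q.tgt p.1) p.2.1 k * (g (Q.src p.1))⁻¹ l p.2.2) *
      MvPolynomial.X (p.1, k, l)

/-- `f` belongs to the algebra of invariants `Inv(Q,(2,…,2))`. -/
def IsInvariant (f : MvPolynomial Q.Var K) : Prop :=
  ∀ g : Q.V → Matrix (Fin 2) (Fin 2) K, (∀ v, IsUnit (g v).det) →
    MvPolynomial.aeval (Q.actVar K g) f = f

/-- The space `Inv(Q,(2,…,2))⁺` of invariants without constant term (the span of the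
homogeneous invariants of positive degree). -/
def PlusSet : Set (MvPolynomial Q.Var K) :=
  {f | Q.IsInvariant K f ∧ MvPolynomial.constantCoeff f = 0}

/-- `f` is decomposable: it lies in the ideal `(Inv⁺)²`, i.e. in the `K`-span of
products of two invariants of positive degree. -/
def Decomposable (f : MvPolynomial Q.Var K) : Prop :=
  f ∈ Submodule.span K
    {x : MvPolynomial Q.Var K | ∃ p ∈ Q.PlusSet K, ∃ q ∈ Q.PlusSet K, x = p * q}

/-- The generic `2 × 2` matrix `X_a` of an arrow `a`. -/
noncomputable def genMat (a : Q.A) : Matrix (Fin 2) (Fin 2) (MvPolynomial Q.Var K) :=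
  Matrix.of fun i j => MvPolynomial.X (a, i, j)

/-- For a path `l = a₁⋯a_s`, the matrix product `X_{a_s} ⋯ X_{a_1}`. -/
noncomputable def pathMat (l : List Q.A) : Matrix (Fin 2) (Fin 2) (MvPolynomial Q.Var K) :=
  ((l.map (Q.genMat K)).reverse).prod

/-- `tr(X_{a_s} ⋯ X_{a_1})` for a path `l = a₁⋯a_s`. -/
noncomputable def pathTr (l : List Q.A) : MvPolynomial Q.Var K :=
  Matrix.trace (Q.pathMat K l)

/-- `det(X_{a_s} ⋯ X_{a_1})` for a path `l = a₁⋯a_s`. -/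
noncomputable def pathDet (l : List Q.A) : MvPolynomial Q.Var K :=
  Matrix.det (Q.pathMat K l)

/-- `σ_k(X_{a_s} ⋯ X_{a_1})`, the `k`-th coefficient of the characteristic polynomial
of the `2 × 2` matrix `X_{a_s} ⋯ X_{a_1}` (which vanishes for `k > 2`). -/
noncomputable def pathSigma (k : ℕ) (l : List Q.A) : MvPolynomial Q.Var K :=
  if k = 0 then 1 else if k = 1 then Q.pathTr K l
    else if k = 2 then Q.pathDet K l else 0

/-- `D(Q,(2,…,2))`: the maximal degree of an indecomposable homogeneous invariant,
i.e. the least upper bound for the degrees of elements of a minimal homogeneous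
system of generators of `Inv(Q,(2,…,2))`. -/
noncomputable def Dnum : ℕ :=
  sSup {k | ∃ f : MvPolynomial Q.Var K,
    Q.IsInvariant K f ∧ f.IsHomogeneous k ∧ ¬ Q.Decomposable K f}

end QuiverData

/-- `max {D(Q,(2,…,2)) | Q ∈ 𝒬(n,d,m)}` where `𝒬(n,d,m)` is the set of strongly
connected quivers with `n` vertices (vertex set `Fin n`), `d` arrows (arrow set `Fin d`)
and maximal degree of primitive closed paths equal to `m`. -/
noncomputable def QuiverData.maxD (K : Type) [Field K] (n d m : ℕ) : ℕ :=
  sSup {N | ∃ s t : Fin d → Fin n,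
    (QuiverData.mk (Fin n) (Fin d) s t).StronglyConnected ∧
    (QuiverData.mk (Fin n) (Fin d) s t).MaxPrimDeg m ∧
    N = (QuiverData.mk (Fin n) (Fin d) s t).Dnum K}

namespace QuiverData

variable (Q : QuiverData) (K : Type) [Field K]

theorem aux_path_append (u w : Q.V) (l₁ l₂ : List Q.A) :
    Q.IsPathFrom u w (l₁ ++ l₂) ↔ ∃ x, Q.IsPathFrom u x l₁ ∧ Q.IsPathFrom x w l₂ := by
  induction l₁ generalizing u with
  | nil => simp [IsPathFrom]
  | cons a l ih =>
    simp only [List.cons_append, IsPathFrom, ih]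
    constructor
    · rintro ⟨h, x, h1, h2⟩
      exact ⟨x, ⟨h, h1⟩, h2⟩
    · rintro ⟨x, ⟨h, h1⟩, h2⟩
      exact ⟨h, x, h1, h2⟩

theorem aux_path_end (u w : Q.V) (l : List Q.A) (a : Q.A)
    (h : Q.IsPathFrom u w (l ++ [a])) : Q.tgt a = w := by
  rw [aux_path_append] at h
  obtain ⟨x, -, h2⟩ := h
  exact h2.2

theorem aux_pathDet_append (l₁ l₂ : List Q.A) :
    Q.pathDet K (l₁ ++ l₂) = Q.pathDet K l₁ * Q.pathDet K l₂ := by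
  simp [pathDet, pathMat, mul_comm]

theorem aux_pathDet_cons (a : Q.A) (l : List Q.A) :
    Q.pathDet K (a :: l) = (Q.genMat K a).det * Q.pathDet K l := by
  simp [pathDet, pathMat, mul_comm]

theorem aux_act_genMat (g : Q.V → Matrix (Fin 2) (Fin 2) K) (a : Q.A) :
    MvPolynomial.aeval (Q.actVar K g) (Q.genMat K a).det =
      MvPolynomial.C ((g (Q.tgt a)).det * (g (Q.src a))⁻¹.det) * (Q.genMat K a).det := by
  have hX : ∀ i j, MvPolynomial.aeval (Q.actVar K g) (Q.genMat K a i j) =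
      ∑ k : Fin 2, ∑ l : Fin 2,
        MvPolynomial.C (g (Q.tgt a) i k * (g (Q.src a))⁻¹ l j) * Q.genMat K a k l :=
    fun i j => MvPolynomial.aeval_X (Q.actVar K g) (a, i, j)
  simp only [Matrix.det_fin_two, map_sub, map_mul, hX, Fin.sum_univ_two]
  ring

theorem aux_act_path (g : Q.V → Matrix (Fin 2) (Fin 2) K) (hg : ∀ v, IsUnit (g v).det)
    (u w : Q.V) (l : List Q.A) (h : Q.IsPathFrom u w l) :
    MvPolynomial.aeval (Q.actVar K g) (Q.pathDet K l) =
      MvPolynomial.C ((g w).det * ((g u).det)⁻¹) * Q.pathDet K l := by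
  induction l generalizing u with
  | nil =>
    have : u = w := h
    subst this
    rw [mul_inv_cancel₀ (hg u).ne_zero]
    simp [pathDet, pathMat]
  | cons a l ih =>
    obtain ⟨rfl, h⟩ := h
    rw [aux_pathDet_cons, map_mul, ih _ h, aux_act_genMat, Matrix.det_nonsing_inv,
      Ring.inverse_eq_inv']
    have : (g w).det * (g (Q.src a)).det⁻¹ =
        ((g (Q.tgt a)).det * (g (Q.src a)).det⁻¹) * ((g w).det * (g (Q.tgt a)).det⁻¹) := by
      have := (hg (Q.tgt a)).ne_zero
      field_simp
    rw [this]
    simp only [map_mul]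
    ring

theorem aux_plus (w : Q.V) (l : List Q.A) (h : Q.IsClosedAt w l) :
    Q.pathDet K l ∈ Q.PlusSet K := by
  refine ⟨fun g hg => ?_, ?_⟩
  · rw [aux_act_path Q K g hg w w l h.2, mul_inv_cancel₀ (hg w).ne_zero]
    simp
  · obtain ⟨h0, -⟩ := h
    cases l with
    | nil => exact absurd rfl h0
    | cons a l =>
      rw [aux_pathDet_cons, map_mul]
      have hX : ∀ i j, MvPolynomial.constantCoeff (Q.genMat K a i j) = 0 :=
        fun i j => MvPolynomial.constantCoeff_X K ((a, i, j) : Q.Var)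
      simp [Matrix.det_fin_two, hX]

theorem aux_split (l : List Q.A) (i j : ℕ) (hij : i < j) (hj : j < l.length) :
    ∃ l₁ l₂ l₃, l = (l₁ ++ [l[i]]) ++ ((l₂ ++ [l[j]]) ++ l₃) := by
  refine ⟨l.take i, (l.take j).drop (i + 1), l.drop (j + 1), ?_⟩
  have e1 : l.take j ++ [l[j]] = l.take (j + 1) := by simp
  have e2 : l.take i ++ [l[i]] = (l.take j).take (i + 1) := by
    rw [List.take_take, min_eq_left (by omega)]; simp
  rw [e2, ← List.append_assoc, ← List.append_assoc, List.take_append_drop, e1,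
    List.take_append_drop]

theorem aux_exists_repeat (l : List Q.A) (a : Q.A) (ha : a ∈ l)
    (h : Q.vdeg l (Q.tgt a) ≠ 1) :
    ∃ (i j : ℕ) (hij : i < j) (hj : j < l.length), Q.tgt l[i] = Q.tgt l[j] := by
  obtain ⟨k, hk⟩ := List.get_of_mem ha
  by_contra hcon
  push Not at hcon
  apply h
  rw [vdeg, Nat.card_eq_one_iff_unique]
  refine ⟨⟨?_⟩, ⟨⟨k, by rw [hk]⟩⟩⟩
  rintro ⟨⟨i, hi⟩, hi'⟩ ⟨⟨j, hj⟩, hj'⟩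
  have hh : Q.tgt l[i] = Q.tgt l[j] := hi'.trans hj'.symm
  rcases lt_trichotomy i j with hl | rfl | hl
  · exact absurd hh (hcon i j hl hj)
  · rfl
  · exact absurd hh.symm (hcon j i hl hi)

end QuiverData

/-- **Remark (determinants).** Let `K` be an infinite field, `Q` a strongly connected
quiver with `m(Q) = m` and `a = a₁⋯a_s` a closed path in `Q`. If the invariant
`q = det(X_{a_s}⋯X_{a_1}) ∈ Inv(Q,(2,…,2))` is indecomposable, then
`deg q = 2s ≤ 2m`. -/
theorem det_indecomposable_degree_bound
    (K : Type) [Field K] [Infinite K]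
    (Q : QuiverData) (hsc : Q.StronglyConnected) (m : ℕ) (hm : Q.MaxPrimDeg m)
    (v : Q.V) (l : List Q.A) (hl : Q.IsClosedAt v l)
    (hind : ¬ Q.Decomposable K (Q.pathDet K l)) :
    2 * l.length ≤ 2 * m := by
  by_contra hlt
  apply hind
  have hnp : ¬ Q.IsPrimitive l := fun hp => hlt (by have := hm.2 l hp; omega)
  have : ∃ a ∈ l, Q.vdeg l (Q.tgt a) ≠ 1 := by
    by_contra hcon
    push Not at hcon
    exact hnp ⟨v, hl, hcon⟩
  obtain ⟨a, ha, hd⟩ := this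
  obtain ⟨i, j, hij, hj, ht⟩ := Q.aux_exists_repeat l a ha hd
  obtain ⟨l₁, l₂, l₃, hs⟩ := Q.aux_split l i j hij hj
  have hpath := hl.2
  rw [hs, Q.aux_path_append] at hpath
  obtain ⟨x, h1, h2⟩ := hpath
  rw [Q.aux_path_append] at h2
  obtain ⟨y, h2, h3⟩ := h2
  have hx := Q.aux_path_end _ _ _ _ h1
  have hy := Q.aux_path_end _ _ _ _ h2
  have hxy : x = y := by rw [← hx, ← hy, ht]
  subst hxy
  refine Submodule.subset_span ⟨_, Q.aux_plus K v ((l₁ ++ [l[i]]) ++ l₃)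
    ⟨by simp, (Q.aux_path_append _ _ _ _).2 ⟨x, h1, h3⟩⟩, _,
    Q.aux_plus K x (l₂ ++ [l[j]]) ⟨by simp, h2⟩, ?_⟩
  conv_lhs => rw [hs]
  simp only [Q.aux_pathDet_append]
  ring
end

section
/- Let K be an infinite field with char(K) ≠ 2 and let Q be a quiver with n vertices. If h is a closed path in Q with h ≢ 0 (with respect to the equivalence ≡ on closed paths of Q), then deg(h) ≤ 3n. -/
open Classical BigOperators

theorem QuiverData.IsPathFrom.append' {Q : QuiverData} : ∀ {l₁ l₂ : List Q.A} {u v w : Q.V},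
    Q.IsPathFrom u v l₁ → Q.IsPathFrom v w l₂ → Q.IsPathFrom u w (l₁ ++ l₂)
  | [], l₂, u, v, w, h₁, h₂ => by
      have h : u = v := h₁
      subst h
      exact h₂
  | a :: l, l₂, u, v, w, h₁, h₂ => ⟨h₁.1, QuiverData.IsPathFrom.append' h₁.2 h₂⟩

/-- Split a path at its first visit to the vertex `w`. -/
theorem QuiverData.split_first {Q : QuiverData} (w : Q.V) (k : ℕ) :
    ∀ (l : List Q.A) (u v : Q.V), Q.IsPathFrom u v l →
      k + 1 ≤ l.countP (fun a => decide (Q.tgt a = w)) →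
      ∃ p r, l = p ++ r ∧ p ≠ [] ∧ Q.IsPathFrom u w p ∧ Q.IsPathFrom w v r ∧
        k ≤ r.countP (fun a => decide (Q.tgt a = w))
  | [], u, v, _, hc => by simp at hc
  | a :: l, u, v, hp, hc => by
      by_cases ha : Q.tgt a = w
      · refine ⟨[a], l, rfl, by simp, ⟨hp.1, ha⟩, ha ▸ hp.2, ?_⟩
        simpa [List.countP_cons, ha] using hc
      · obtain ⟨p, r, h1, h2, h3, h4, h5⟩ := QuiverData.split_first w k l (Q.tgt a) v hp.2
          (by simpa [List.countP_cons, ha] using hc)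
        exact ⟨a :: p, r, by simp [h1], by simp, ⟨hp.1, h3⟩, h4, h5⟩

theorem QuiverData.length_eq_sum_countP {Q : QuiverData} [Fintype Q.V] (l : List Q.A) :
    l.length = ∑ w : Q.V, l.countP (fun a => decide (Q.tgt a = w)) := by
  induction l with
  | nil => simp
  | cons a l ih => simp [List.countP_cons, Finset.sum_add_distrib, ← ih]

/-- **Lemma (char ≠ 2).** Let `K` be an infinite field with `char K ≠ 2` and `Q` a
quiver with `n` vertices. If `h` is a closed path in `Q` with `h ≢ 0`, then
`deg h ≤ 3n`. -/
theorem length_le_of_not_equiv_zero_char_ne_two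
    (K : Type) [Field K] [Infinite K] (hchar : ringChar K ≠ 2)
    (Q : QuiverData) [Fintype Q.V] (n : ℕ) (hn : Fintype.card Q.V = n)
    (v : Q.V) (h : List Q.A) (hcl : Q.IsClosedAt v h)
    (h0 : ¬ Q.EquivZero (ringChar K = 2) h) :
    h.length ≤ 3 * n := by
  by_contra hlt
  push Not at hlt
  obtain ⟨w, hw⟩ : ∃ w : Q.V, 4 ≤ h.countP (fun a => decide (Q.tgt a = w)) := by
    by_contra hno
    push Not at hno
    have h1 := QuiverData.length_eq_sum_countP (Q := Q) h
    have h2 : ∑ w : Q.V, h.countP (fun a => decide (Q.tgt a = w)) ≤ ∑ _w : Q.V, 3 :=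
      Finset.sum_le_sum fun w _ => by have := hno w; omega
    rw [Finset.sum_const, Finset.card_univ, hn, smul_eq_mul] at h2
    omega
  obtain ⟨p, r₁, rfl, hp0, hp, hr₁, hc₁⟩ := QuiverData.split_first w 3 h v v hcl.2 hw
  obtain ⟨c₁, r₂, rfl, h10, h1, hr₂, hc₂⟩ := QuiverData.split_first w 2 r₁ w v hr₁ hc₁
  obtain ⟨c₂, r₃, rfl, h20, h2, hr₃, hc₃⟩ := QuiverData.split_first w 1 r₂ w v hr₂ hc₂
  obtain ⟨c₃, r₄, rfl, h30, h3, hr₄, hc₄⟩ := QuiverData.split_first w 0 r₃ w v hr₃ hc₃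
  apply h0
  refine QuiverData.PEquiv.trans
    (QuiverData.PEquiv.cyc v w p (c₁ ++ (c₂ ++ (c₃ ++ r₄))) false hp hr₁ hcl.1) ?_
  have hf := QuiverData.PEquiv.four (Q := Q) (c2 := ringChar K = 2) w c₁ c₂ c₃ (r₄ ++ p) false
    hchar ⟨h10, h1⟩ ⟨h20, h2⟩ ⟨h30, h3⟩ ⟨by simp [hp0], hr₄.append' hp⟩
  simpa [List.append_assoc] using hf
end

section
/- Let K be an infinite field with char(K) = 2, Q a quiver, h a closed path in Q, v a vertex of Q, and let P be the set of loops of Q at v. Then h ≡ p·b, where p is a product of k ≥ 0 loops from P (a closed path at v, empty if k = 0), b is a possibly empty path, and no loop from P occurs in b. Moreover, suppose a ∈ Q_1 occurs in h and a' ≠ a''; if a' = v then h ≡ a·p·b_0, and if a'' = v then h ≡ p·a·b_0, where again p is a product of loops from P and no loop from P occurs in the possibly empty path b_0. -/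
open Classical BigOperators

namespace QuiverData

theorem isPathFrom_append (Q : QuiverData) (l₁ l₂ : List Q.A) (u z : Q.V) :
    Q.IsPathFrom u z (l₁ ++ l₂) ↔ ∃ y, Q.IsPathFrom u y l₁ ∧ Q.IsPathFrom y z l₂ := by
  induction l₁ generalizing u with
  | nil => simp [IsPathFrom]
  | cons a l ih => simp [IsPathFrom, ih, and_assoc]

/-- Move all loops at `v` occurring in `d` to the left of `c`. -/
theorem loops_collect (Q : QuiverData) (c2 : Prop) (hc2 : c2) (v z : Q.V) (s : List Q.A)
    (hs : Q.IsPathFrom z v s) (d : List Q.A) :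
    ∀ (u : Q.V) (w c : List Q.A), (∀ x ∈ w, Q.src x = v ∧ Q.tgt x = v) →
      Q.IsPathFrom v v w → Q.IsPathFrom v u c → Q.IsPathFrom u z d →
      ∃ p b : List Q.A, (∀ x ∈ p, Q.src x = v ∧ Q.tgt x = v) ∧
        (∀ x ∈ b, ¬(Q.src x = v ∧ Q.tgt x = v)) ∧
        Q.IsPathFrom v v p ∧ Q.IsPathFrom v z (c ++ b) ∧
        Q.PathEquiv c2 (w ++ c ++ d ++ s) (p ++ c ++ b ++ s) := by
  induction d with
  | nil =>
    intro u w c hw hww hc hd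
    have hd : u = z := hd
    subst hd
    exact ⟨w, [], hw, by simp, hww, by simpa using hc, PEquiv.refl _⟩
  | cons x d ih =>
    intro u w c hw hww hc hd
    obtain ⟨hx, hd⟩ := hd
    by_cases hl : Q.src x = v ∧ Q.tgt x = v
    · have hxx : Q.IsPathFrom v v [x] := ⟨hl.1, hl.2⟩
      have huv : u = v := hx.symm.trans hl.1
      have hd' : Q.IsPathFrom v z d := hl.2 ▸ hd
      subst huv
      obtain ⟨p, b, h1, h2, h3, h4, h5⟩ := ih u (w ++ [x]) c
        (by
          intro y hy
          rcases List.mem_append.1 hy with hy | hy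
          · exact hw y hy
          · rw [List.mem_singleton.1 hy]; exact hl)
        ((isPathFrom_append Q _ _ _ _).2 ⟨_, hww, hxx⟩) hc hd'
      refine ⟨p, b, h1, h2, h3, h4, PEquiv.trans ?_ h5⟩
      by_cases hcn : c = []
      · subst hcn
        have : w ++ [] ++ x :: d ++ s = w ++ [x] ++ [] ++ d ++ s := by simp
        rw [this]
        exact PEquiv.refl _
      · have := PEquiv.swap (c2 := c2) u w c [x] (d ++ s) false hww ⟨hcn, hc⟩ ⟨by simp, hxx⟩
          ((isPathFrom_append Q _ _ _ _).2 ⟨_, hd', hs⟩)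
        rw [if_pos hc2] at this
        simpa using this
    · obtain ⟨p, b, h1, h2, h3, h4, h5⟩ := ih (Q.tgt x) w (c ++ [x]) hw hww
        ((isPathFrom_append Q _ _ _ _).2 ⟨_, hc, hx, rfl⟩) hd
      refine ⟨p, x :: b, h1, ?_, h3, by simpa using h4, by simpa using h5⟩
      intro y hy
      rcases List.mem_cons.1 hy with hy | hy
      · rw [hy]; exact hl
      · exact h2 y hy

/-- Rotate a closed path so that it starts with a given arrow. -/
theorem rotate_to (Q : QuiverData) (c2 : Prop) (w : Q.V) (h : List Q.A)
    (hcl : Q.IsClosedAt w h) (a : Q.A) (ha : a ∈ h) :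
    ∃ t, Q.IsPathFrom (Q.tgt a) (Q.src a) t ∧ Q.PathEquiv c2 h (a :: t) := by
  obtain ⟨l₁, l₂, rfl⟩ := List.append_of_mem ha
  obtain ⟨y, h1, h2, h3⟩ := (isPathFrom_append Q _ _ _ _).1 hcl.2
  subst h2
  exact ⟨l₂ ++ l₁, (isPathFrom_append Q _ _ _ _).2 ⟨_, h3, h1⟩,
    PEquiv.cyc _ _ l₁ (a :: l₂) false h1 ⟨rfl, h3⟩ (by simp)⟩

end QuiverData

/-- **Lemma (loops).** Let `char K = 2`, `h` a closed path in `Q` and let `P` be the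
set of loops of `Q` at a vertex `v`. Then `h ≡ p·b` where `p` is a product of `k ≥ 0`
loops from `P`, `b` is a possibly empty path and no loop from `P` occurs in `b`.
Moreover, if an arrow `a` with `a' ≠ a''` occurs in `h`, then: if `a' = v` then
`h ≡ a·p·b₀`, and if `a'' = v` then `h ≡ p·a·b₀`, with `p`, `b₀` as above. -/
theorem loops_first
    (K : Type) [Field K] [Infinite K] (hchar : ringChar K = 2)
    (Q : QuiverData) (w : Q.V) (v : Q.V) (h : List Q.A) (hcl : Q.IsClosedAt w h) :
    (∃ p b : List Q.A,
      (∀ x ∈ p, Q.src x = v ∧ Q.tgt x = v) ∧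
      (∀ x ∈ b, ¬(Q.src x = v ∧ Q.tgt x = v)) ∧
      Q.PathEquiv (ringChar K = 2) h (p ++ b)) ∧
    (∀ a : Q.A, a ∈ h → Q.tgt a ≠ Q.src a →
      (Q.tgt a = v → ∃ p b : List Q.A,
        (∀ x ∈ p, Q.src x = v ∧ Q.tgt x = v) ∧
        (∀ x ∈ b, ¬(Q.src x = v ∧ Q.tgt x = v)) ∧
        Q.PathEquiv (ringChar K = 2) h (a :: (p ++ b))) ∧
      (Q.src a = v → ∃ p b : List Q.A,
        (∀ x ∈ p, Q.src x = v ∧ Q.tgt x = v) ∧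
        (∀ x ∈ b, ¬(Q.src x = v ∧ Q.tgt x = v)) ∧
        Q.PathEquiv (ringChar K = 2) h (p ++ a :: b))) := by
  refine ⟨?_, ?_⟩
  · by_cases hex : ∃ x ∈ h, Q.src x = v ∧ Q.tgt x = v
    · obtain ⟨x, hx, hs, ht⟩ := hex
      obtain ⟨t, h1, h2⟩ := Q.rotate_to (ringChar K = 2) w h hcl x hx
      rw [hs, ht] at h1
      obtain ⟨p, b, g1, g2, -, -, g5⟩ := Q.loops_collect (ringChar K = 2) hchar v v [] rfl
        t v [x] [] (by simpa using And.intro hs ht) ⟨hs, ht⟩ rfl h1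
      exact ⟨p, b, g1, g2, h2.trans (by simpa [QuiverData.PathEquiv] using g5)⟩
    · refine ⟨[], h, by simp, ?_, QuiverData.PEquiv.refl _⟩
      intro x hx hl
      exact hex ⟨x, hx, hl⟩
  · intro a ha hne
    obtain ⟨t, h1, h2⟩ := Q.rotate_to (ringChar K = 2) w h hcl a ha
    refine ⟨?_, ?_⟩
    · intro hv
      subst hv
      obtain ⟨p, b, g1, g2, g3, g4, g5⟩ := Q.loops_collect (ringChar K = 2) hchar
        (Q.tgt a) (Q.src a) [a] ⟨rfl, rfl⟩ t (Q.tgt a) [] [] (by simp) rfl rfl h1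
      refine ⟨p, b, g1, g2, h2.trans (QuiverData.PEquiv.trans
        (QuiverData.PEquiv.cyc (Q.src a) (Q.tgt a) [a] t false ⟨rfl, rfl⟩ h1 (by simp))
        (QuiverData.PEquiv.trans g5 ?_))⟩
      have := QuiverData.PEquiv.cyc (c2 := (ringChar K = 2)) (Q.tgt a) (Q.src a) (p ++ b) [a]
        false ((Q.isPathFrom_append _ _ _ _).2 ⟨_, g3, g4⟩) ⟨rfl, rfl⟩ (by simp)
      simpa using this
    · intro hv
      subst hv
      obtain ⟨p, b, g1, g2, g3, g4, g5⟩ := Q.loops_collect (ringChar K = 2) hchar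
        (Q.src a) (Q.src a) [] rfl t (Q.tgt a) [] [a] (by simp) rfl ⟨rfl, rfl⟩ h1
      exact ⟨p, b, g1, g2, h2.trans (by simpa [QuiverData.PathEquiv] using g5)⟩
end

section
/- Let K be an infinite field with char(K) = 2 and let Q be a quiver with exactly two vertices u and v, whose arrows consist of a set P of loops at u, a set R of loops at v, a set X of arrows from u to v, and a set Y of arrows from v to u. Let h be a closed path in Q in which at least one arrow from X ∪ Y occurs. Then h ≡ p · x · q · y · w, where p is a product of i ≥ 0 loops from P, x ∈ X, q is a product of j ≥ 0 loops from R, y ∈ Y, and w = (x̂_1 ŷ_1)(x̂_2 ŷ_2)⋯(x̂_k ŷ_k) for some k ≥ 0 with x̂_l ∈ X and ŷ_l ∈ Y. -/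
open Classical BigOperators

namespace QuiverData

variable {Q : QuiverData}

theorem isPathFrom_append_s12 {l m : List Q.A} {a b c : Q.V}
    (h1 : Q.IsPathFrom a b l) (h2 : Q.IsPathFrom b c m) : Q.IsPathFrom a c (l ++ m) := by
  induction l generalizing a with
  | nil => cases h1; exact h2
  | cons x l ih => exact ⟨h1.1, ih h1.2⟩

theorem isPathFrom_loops {l : List Q.A} {a : Q.V}
    (h : ∀ z ∈ l, Q.src z = a ∧ Q.tgt z = a) : Q.IsPathFrom a a l := by
  induction l with
  | nil => rfl
  | cons x l ih =>
    have hx := h x (by simp)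
    refine ⟨hx.1, ?_⟩
    rw [hx.2]
    exact ih fun z hz => h z (by simp [hz])

/-- Contextual equivalence of two paths from `a` to `b`. -/
def CtxEquiv (Q : QuiverData) (c2 : Prop) (a b : Q.V) (l m : List Q.A) : Prop :=
  ∀ (s t : Q.V) (α β : List Q.A), Q.IsPathFrom s a α → Q.IsPathFrom b s β →
    Q.PEquiv c2 (some (false, α ++ l ++ β)) (some (false, α ++ m ++ β))

theorem CtxEquiv.refl' (c2 : Prop) (a b : Q.V) (l : List Q.A) : Q.CtxEquiv c2 a b l l :=
  fun _ _ _ _ _ _ => PEquiv.refl _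

theorem CtxEquiv.trans' {c2 : Prop} {a b : Q.V} {l m n : List Q.A}
    (h1 : Q.CtxEquiv c2 a b l m) (h2 : Q.CtxEquiv c2 a b m n) : Q.CtxEquiv c2 a b l n :=
  fun s t α β hα hβ => (h1 s t α β hα hβ).trans (h2 s t α β hα hβ)

theorem CtxEquiv.ctx {c2 : Prop} {a b a' b' : Q.V} {l m γ δ : List Q.A}
    (h : Q.CtxEquiv c2 a b l m) (hγ : Q.IsPathFrom a' a γ) (hδ : Q.IsPathFrom b b' δ) :
    Q.CtxEquiv c2 a' b' (γ ++ l ++ δ) (γ ++ m ++ δ) := by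
  intro s t α β hα hβ
  have := h s t (α ++ γ) (δ ++ β) (isPathFrom_append_s12 hα hγ) (isPathFrom_append_s12 hδ hβ)
  simpa using this

theorem ctxEquiv_swap {c2 : Prop} (h2 : c2) {a : Q.V} {c d : List Q.A}
    (hc : Q.IsPathFrom a a c) (hd : Q.IsPathFrom a a d) :
    Q.CtxEquiv c2 a a (c ++ d) (d ++ c) := by
  intro s t α β hα hβ
  by_cases c0 : c = []
  · subst c0; simpa using PEquiv.refl _
  by_cases d0 : d = []
  · subst d0; simpa using PEquiv.refl _
  have e1 := PEquiv.cyc (Q := Q) (c2 := c2) s a α (c ++ d ++ β) false hα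
    (isPathFrom_append_s12 (isPathFrom_append_s12 hc hd) hβ) (by simp [c0])
  have e2 := PEquiv.swap (Q := Q) (c2 := c2) a [] c d (β ++ α) false rfl ⟨c0, hc⟩ ⟨d0, hd⟩
    (isPathFrom_append_s12 hβ hα)
  have e3 := PEquiv.cyc (Q := Q) (c2 := c2) s a α (d ++ c ++ β) false hα
    (isPathFrom_append_s12 (isPathFrom_append_s12 hd hc) hβ) (by simp [c0])
  rw [if_pos h2] at e2
  have e1' : Q.PEquiv c2 (some (false, α ++ (c ++ d) ++ β))
      (some (false, [] ++ c ++ d ++ (β ++ α))) := by simpa using e1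
  have e3' : Q.PEquiv c2 (some (false, α ++ (d ++ c) ++ β))
      (some (false, [] ++ d ++ c ++ (β ++ α))) := by simpa using e3
  exact (e1'.trans e2).trans e3'.symm

theorem split_path {u v : Q.V} (hall : ∀ z : Q.V, z = u ∨ z = v) (z : Q.V) (l : List Q.A)
    (hl : Q.IsPathFrom v z l) :
    ((∀ a ∈ l, Q.src a = v ∧ Q.tgt a = v) ∧ v = z) ∨
    ∃ q y r, l = q ++ y :: r ∧ (∀ a ∈ q, Q.src a = v ∧ Q.tgt a = v) ∧
      (Q.src y = v ∧ Q.tgt y = u) ∧ Q.IsPathFrom u z r := by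
  induction l with
  | nil => exact Or.inl ⟨by simp, hl⟩
  | cons a l ih =>
    obtain ⟨h1, h2⟩ := hl
    rcases hall (Q.tgt a) with ht | ht
    · rw [ht] at h2
      exact Or.inr ⟨[], a, l, rfl, by simp, ⟨h1, ht⟩, h2⟩
    · rw [ht] at h2
      rcases ih h2 with ⟨h3, h4⟩ | ⟨q, y, r, rfl, hq, hy, hr⟩
      · refine Or.inl ⟨?_, h4⟩
        simpa [h1, ht] using h3
      · refine Or.inr ⟨a :: q, y, r, rfl, ?_, hy, hr⟩
        simpa [h1, ht] using hq

/-- Every closed path in `u` is a product of loops or has the normal form. -/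
theorem normal_form {c2 : Prop} (h2 : c2) {u v : Q.V} (huv : u ≠ v)
    (hall : ∀ z : Q.V, z = u ∨ z = v) (n : ℕ) :
    ∀ l : List Q.A, l.length ≤ n → Q.IsPathFrom u u l →
    (∀ a ∈ l, Q.src a = u ∧ Q.tgt a = u) ∨
    ∃ (p : List Q.A) (x : Q.A) (q : List Q.A) (y : Q.A) (k : ℕ)
      (xs ys : Fin k → Q.A),
      (∀ z ∈ p, Q.src z = u ∧ Q.tgt z = u) ∧
      (Q.src x = u ∧ Q.tgt x = v) ∧
      (∀ z ∈ q, Q.src z = v ∧ Q.tgt z = v) ∧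
      (Q.src y = v ∧ Q.tgt y = u) ∧
      (∀ l, Q.src (xs l) = u ∧ Q.tgt (xs l) = v) ∧
      (∀ l, Q.src (ys l) = v ∧ Q.tgt (ys l) = u) ∧
      Q.IsPathFrom u u (List.ofFn fun l => [xs l, ys l]).flatten ∧
      Q.CtxEquiv c2 u u l
        (p ++ x :: q ++ y :: (List.ofFn fun l => [xs l, ys l]).flatten) := by
  induction n with
  | zero =>
    intro l hl _
    have : l = [] := by simpa using hl
    subst this
    exact Or.inl (by simp)
  | succ n ih =>
    intro l hl hp
    rcases split_path (u := v) (v := u) (fun z => (hall z).symm) u l hp with h | h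
    · exact Or.inl h.1
    right
    obtain ⟨p, x, r, rfl, hpl, hx, hr⟩ := h
    rcases split_path hall u r hr with h | h
    · exact absurd h.2.symm huv
    obtain ⟨q, y, r, rfl, hq, hy, hr⟩ := h
    have hpp := isPathFrom_loops hpl
    have hqp := isPathFrom_loops hq
    have hxp : Q.IsPathFrom u v [x] := ⟨hx.1, hx.2⟩
    have hyp : Q.IsPathFrom v u [y] := ⟨hy.1, hy.2⟩
    have hB : Q.IsPathFrom u u ([x] ++ q ++ [y]) :=
      isPathFrom_append_s12 (isPathFrom_append_s12 hxp hqp) hyp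
    rcases ih r (by simp at hl; omega) hr with h | h
    · refine ⟨p ++ r, x, q, y, 0, Fin.elim0, Fin.elim0, ?_, hx, hq, hy,
        fun l => l.elim0, fun l => l.elim0, rfl, ?_⟩
      · intro z hz
        rcases List.mem_append.1 hz with hz | hz
        exacts [hpl z hz, h z hz]
      · have e := (ctxEquiv_swap h2 hB hr).ctx hpp (b' := u) (δ := []) rfl
        simpa using e
    · obtain ⟨p', x', q', y', k, xs, ys, hp', hx', hq', hy', hxs, hys, hw, he⟩ := h
      have hpp' := isPathFrom_loops hp'
      have hqp' := isPathFrom_loops hq'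
      have hxp' : Q.IsPathFrom u v [x'] := ⟨hx'.1, hx'.2⟩
      have hyp' : Q.IsPathFrom v u [y'] := ⟨hy'.1, hy'.2⟩
      refine ⟨p ++ p', x, q ++ q', y, k + 1, Fin.cons x' xs, Fin.cons y' ys, ?_, hx, ?_, hy,
        ?_, ?_, ?_, ?_⟩
      · intro z hz
        rcases List.mem_append.1 hz with hz | hz
        exacts [hpl z hz, hp' z hz]
      · intro z hz
        rcases List.mem_append.1 hz with hz | hz
        exacts [hq z hz, hq' z hz]
      · intro l
        refine Fin.cases ?_ (fun i => ?_) l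
        · simpa using hx'
        · simpa using hxs i
      · intro l
        refine Fin.cases ?_ (fun i => ?_) l
        · simpa using hy'
        · simpa using hys i
      · simp only [List.ofFn_succ, Fin.cons_zero, Fin.cons_succ, List.flatten_cons]
        exact isPathFrom_append_s12 (isPathFrom_append_s12 hxp' hyp') hw
      · simp only [List.ofFn_succ, Fin.cons_zero, Fin.cons_succ, List.flatten_cons]
        generalize (List.ofFn fun l => [xs l, ys l]).flatten = w at hw he ⊢
        have e1 := he.ctx (isPathFrom_append_s12 hpp hB) (b' := u) (δ := []) rfl
        have e2 := (ctxEquiv_swap h2 hB hpp').ctx hpp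
          (isPathFrom_append_s12 (isPathFrom_append_s12 (isPathFrom_append_s12 hxp' hqp') hyp') hw)
        have e3 := (ctxEquiv_swap h2 (isPathFrom_append_s12 hyp hxp') hqp').ctx
          (isPathFrom_append_s12 (isPathFrom_append_s12 (isPathFrom_append_s12 hpp hpp') hxp) hqp)
          (isPathFrom_append_s12 hyp' hw)
        simp only [List.append_assoc, List.cons_append, List.nil_append,
          List.append_nil] at e1 e2 e3 ⊢
        exact (e1.trans' e2).trans' e3

end QuiverData

/-- **Lemma (two-vertex quiver, part a).** Let `char K = 2` and let `Q` be a quiver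
with exactly two vertices `u ≠ v`, so that its arrows consist of the loops at `u`
(the set `P`), the loops at `v` (the set `R`), the arrows `u → v` (the set `X`) and
the arrows `v → u` (the set `Y`).  If `h` is a closed path in which at least one arrow
from `X ∪ Y` occurs, then `h ≡ p·x·q·y·(x̂₁ŷ₁)⋯(x̂_kŷ_k)` where `p` is a product of
`i ≥ 0` loops from `P`, `x ∈ X`, `q` is a product of `j ≥ 0` loops from `R`, `y ∈ Y`,
`k ≥ 0`, `x̂_l ∈ X` and `ŷ_l ∈ Y`. -/
theorem two_vertex_normal_form
    (K : Type) [Field K] [Infinite K] (hchar : ringChar K = 2)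
    (Q : QuiverData) (u v : Q.V) (huv : u ≠ v) (hall : ∀ z : Q.V, z = u ∨ z = v)
    (w₀ : Q.V) (h : List Q.A) (hcl : Q.IsClosedAt w₀ h)
    (hocc : ∃ a ∈ h, (Q.src a = u ∧ Q.tgt a = v) ∨ (Q.src a = v ∧ Q.tgt a = u)) :
    ∃ (p : List Q.A) (x : Q.A) (q : List Q.A) (y : Q.A) (k : ℕ)
      (xs ys : Fin k → Q.A),
      (∀ z ∈ p, Q.src z = u ∧ Q.tgt z = u) ∧
      (Q.src x = u ∧ Q.tgt x = v) ∧
      (∀ z ∈ q, Q.src z = v ∧ Q.tgt z = v) ∧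
      (Q.src y = v ∧ Q.tgt y = u) ∧
      (∀ l, Q.src (xs l) = u ∧ Q.tgt (xs l) = v) ∧
      (∀ l, Q.src (ys l) = v ∧ Q.tgt (ys l) = u) ∧
      Q.PathEquiv (ringChar K = 2) h
        (p ++ x :: q ++ y :: (List.ofFn fun l => [xs l, ys l]).flatten) := by
  rcases hall w₀ with rfl | rfl
  · rcases QuiverData.normal_form hchar huv hall h.length h le_rfl hcl.2 with H | H
    · obtain ⟨a, ha, H'⟩ := hocc
      have := H a ha
      grind
    · obtain ⟨p, x, q, y, k, xs, ys, h1, h3, h4, h5, h6, h7, _, he⟩ := H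
      refine ⟨p, x, q, y, k, xs, ys, h1, h3, h4, h5, h6, h7, ?_⟩
      have e := he w₀ w₀ [] [] rfl rfl
      simp only [List.nil_append, List.append_nil] at e
      exact e
  · rcases QuiverData.split_path hall w₀ h hcl.2 with H | H
    · obtain ⟨a, ha, H'⟩ := hocc
      have := H.1 a ha
      grind
    · obtain ⟨q0, y0, r, rfl, hq0, hy0, hr⟩ := H
      have hy0p : Q.IsPathFrom w₀ u (q0 ++ [y0]) :=
        QuiverData.isPathFrom_append_s12 (QuiverData.isPathFrom_loops hq0) ⟨hy0.1, hy0.2⟩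
      have ec := QuiverData.PEquiv.cyc (Q := Q) (c2 := ringChar K = 2) w₀ u (q0 ++ [y0]) r
        false hy0p hr (by simp)
      rcases QuiverData.normal_form hchar huv hall _ (r ++ (q0 ++ [y0])) le_rfl
        (QuiverData.isPathFrom_append_s12 hr hy0p) with H | H
      · have := H y0 (by simp)
        grind
      · obtain ⟨p, x, q, y, k, xs, ys, h1, h3, h4, h5, h6, h7, _, he⟩ := H
        refine ⟨p, x, q, y, k, xs, ys, h1, h3, h4, h5, h6, h7, ?_⟩
        have e := he u u [] [] rfl rfl
        simp only [List.nil_append, List.append_nil] at e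
        have ec' : Q.PEquiv (ringChar K = 2) (some (false, q0 ++ y0 :: r))
          (some (false, r ++ (q0 ++ [y0]))) := by simpa using ec
        exact ec'.trans e
end

section
/- Let K be an infinite field with char(K) = 2 and let Q be a quiver with exactly two vertices u and v, whose arrows consist of a set P of loops at u, a set R of loops at v, a set X of arrows from u to v, and a set Y of arrows from v to u. Let h be a closed path in Q such that some arrow x_1 ∈ X occurs at least twice in h, some arrow y_1 ∈ Y occurs at least twice in h, and the total number of occurrences in h of arrows from X ∪ Y is strictly greater than 4. Then h ≡ (x_1 y_1)² f for some path f. -/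
open Classical BigOperators

namespace QuiverData

theorem path_append {Q : QuiverData} {a b : List Q.A} {u w z : Q.V}
    (ha : Q.IsPathFrom u w a) (hb : Q.IsPathFrom w z b) : Q.IsPathFrom u z (a ++ b) := by
  induction a generalizing u with
  | nil => simp only [IsPathFrom] at ha; subst ha; simpa using hb
  | cons c l ih => exact ⟨ha.1, ih ha.2⟩

theorem path_split {Q : QuiverData} {a b : List Q.A} {u z : Q.V}
    (h : Q.IsPathFrom u z (a ++ b)) : ∃ w, Q.IsPathFrom u w a ∧ Q.IsPathFrom w z b := by
  induction a generalizing u with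
  | nil => exact ⟨u, rfl, h⟩
  | cons c l ih =>
    obtain ⟨w, h1, h2⟩ := ih h.2
    exact ⟨w, ⟨h.1, h1⟩, h2⟩

theorem path_split_cons {Q : QuiverData} {a b : List Q.A} {c : Q.A} {u z : Q.V}
    (h : Q.IsPathFrom u z (a ++ c :: b)) :
    Q.IsPathFrom u (Q.src c) a ∧ Q.IsPathFrom (Q.tgt c) z b := by
  obtain ⟨w, h1, h2⟩ := path_split h
  obtain ⟨h2, h3⟩ := h2
  subst h2
  exact ⟨h1, h3⟩

theorem zero_rot {Q : QuiverData} {c2 : Prop} {u v : Q.V} {a b : List Q.A}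
    (ha : Q.IsPathFrom u v a) (hb : Q.IsPathFrom v u b)
    (h : Q.EquivZero c2 (b ++ a)) : Q.EquivZero c2 (a ++ b) := by
  by_cases hn : a ++ b = []
  · simp only [List.append_eq_nil_iff] at hn
    obtain ⟨rfl, rfl⟩ := hn
    exact h
  · exact (PEquiv.cyc u v a b false ha hb hn).trans h

theorem zero_swap {Q : QuiverData} {c2 : Prop} (hc : c2) (v : Q.V) (w₁ c d w₂ : List Q.A)
    (h1 : Q.IsPathFrom v v w₁) (hc' : Q.IsPathFrom v v c) (hd : Q.IsPathFrom v v d)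
    (h2 : Q.IsPathFrom v v w₂)
    (h : Q.EquivZero c2 (w₁ ++ d ++ c ++ w₂)) : Q.EquivZero c2 (w₁ ++ c ++ d ++ w₂) := by
  by_cases hn : c = []
  · subst hn; simpa using h
  by_cases hm : d = []
  · subst hm; simpa using h
  have := PEquiv.swap (c2 := c2) v w₁ c d w₂ false h1 ⟨hn, hc'⟩ ⟨hm, hd⟩ h2
  rw [if_pos hc] at this
  exact this.trans h

/-- `x r y x y p ≡ 0` when `p` passes through the other vertex. -/
theorem zero_core {Q : QuiverData} {c2 : Prop} (hc : c2) {u v : Q.V} {x y r p₁ p₂ : List Q.A}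
    (hx : Q.IsPathFrom u v x) (hy : Q.IsPathFrom v u y) (hr : Q.IsPathFrom v v r)
    (h1 : Q.IsPathFrom u v p₁) (h2 : Q.IsPathFrom v u p₂) (hne : x ≠ []) (hp : p₁ ≠ []) :
    Q.EquivZero c2 (x ++ r ++ y ++ x ++ y ++ (p₁ ++ p₂)) := by
  have e : x ++ r ++ y ++ x ++ y ++ (p₁ ++ p₂) = x ++ (r ++ y ++ x ++ y ++ p₁ ++ p₂) := by simp
  rw [e]
  refine zero_rot hx (path_append (path_append (path_append (path_append
    (path_append hr hy) hx) hy) h1) h2) ?_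
  have := zero_swap hc v [] r (y ++ x ++ y ++ p₁) (p₂ ++ x) rfl hr
    (path_append (path_append (path_append hy hx) hy) h1) (path_append h2 hx)
  simp only [List.append_assoc, List.nil_append] at this ⊢
  refine this ?_
  have e : y ++ (x ++ (y ++ (p₁ ++ (r ++ (p₂ ++ x)))))
    = (y ++ x ++ y ++ p₁ ++ r ++ p₂) ++ x := by simp
  rw [e]
  refine zero_rot (path_append (path_append (path_append (path_append
    (path_append hy hx) hy) h1) hr) h2) hx ?_
  have := PEquiv.sq_mul (c2 := c2) u (x ++ y) (p₁ ++ r ++ p₂) false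
    ⟨by simp [hne], path_append hx hy⟩
    ⟨by simp [hp], path_append (path_append h1 hr) h2⟩
  simpa [EquivZero] using this

/-- Exchange of the roles of the two vertices. -/
theorem zero_flip {Q : QuiverData} {c2 : Prop} (hc : c2) {u v : Q.V} {x y r p : List Q.A}
    (hx : Q.IsPathFrom u v x) (hy : Q.IsPathFrom v u y) (hr : Q.IsPathFrom v v r)
    (hp : Q.IsPathFrom u u p)
    (h : Q.EquivZero c2 (y ++ p ++ x ++ y ++ x ++ r)) :
    Q.EquivZero c2 (x ++ r ++ y ++ x ++ y ++ p) := by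
  have e : x ++ r ++ y ++ x ++ y ++ p = (x ++ r ++ y ++ x) ++ (y ++ p) := by simp
  rw [e]
  refine zero_rot (path_append (path_append (path_append hx hr) hy) hx)
    (path_append hy hp) ?_
  have := zero_swap hc v (y ++ p ++ x) r (y ++ x) []
    (path_append (path_append hy hp) hx) hr (path_append hy hx) rfl
  simp only [List.append_assoc, List.append_nil] at this h ⊢
  exact this h

/-- A path from `u` to `u` with an arrow touching `v` passes through `v`. -/
theorem split_through {Q : QuiverData} {u v : Q.V} (huv : u ≠ v) {p : List Q.A}
    (hp : Q.IsPathFrom u u p) {a : Q.A} (ha : a ∈ p) (hav : Q.src a = v ∨ Q.tgt a = v) :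
    ∃ p₁ p₂, p = p₁ ++ p₂ ∧ p₁ ≠ [] ∧ Q.IsPathFrom u v p₁ ∧ Q.IsPathFrom v u p₂ := by
  obtain ⟨s, t, rfl⟩ := List.append_of_mem ha
  obtain ⟨h1, h2⟩ := path_split_cons hp
  rcases hav with rfl | rfl
  · refine ⟨s, a :: t, rfl, ?_, h1, rfl, h2⟩
    rintro rfl
    exact huv h1
  · refine ⟨s ++ [a], t, by simp, by simp, path_append h1 ⟨rfl, rfl⟩, h2⟩

theorem zero_core' {Q : QuiverData} {c2 : Prop} (hc : c2) {u v : Q.V} (huv : u ≠ v)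
    {x y r p : List Q.A}
    (hx : Q.IsPathFrom u v x) (hy : Q.IsPathFrom v u y) (hr : Q.IsPathFrom v v r)
    (hp : Q.IsPathFrom u u p) (hne : x ≠ []) (hne' : y ≠ []) {a : Q.A} (ha : a ∈ r ++ p)
    (hS : (Q.src a = u ∧ Q.tgt a = v) ∨ (Q.src a = v ∧ Q.tgt a = u)) :
    Q.EquivZero c2 (x ++ r ++ y ++ x ++ y ++ p) := by
  rcases List.mem_append.1 ha with ha | ha
  · obtain ⟨p₁, p₂, rfl, h0, h1, h2⟩ := split_through (v := u) huv.symm hr ha (by tauto)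
    exact zero_flip hc hx hy hr hp (zero_core hc hy hx hp h1 h2 hne' h0)
  · obtain ⟨p₁, p₂, rfl, h0, h1, h2⟩ := split_through (v := v) huv hp ha (by tauto)
    exact zero_core hc hx hy hr h1 h2 hne h0

/-- Alternating case `x a₁ y a₂ x b₁ y b₂`. -/
theorem zero_alt {Q : QuiverData} {c2 : Prop} (hc : c2) {u v : Q.V} (huv : u ≠ v)
    {x y a₁ a₂ b₁ b₂ : List Q.A}
    (hx : Q.IsPathFrom u v x) (hy : Q.IsPathFrom v u y) (ha1 : Q.IsPathFrom v v a₁)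
    (ha2 : Q.IsPathFrom u u a₂) (hb1 : Q.IsPathFrom v v b₁) (hb2 : Q.IsPathFrom u u b₂)
    (hne : x ≠ []) (hne' : y ≠ []) {a : Q.A} (ha : a ∈ a₁ ++ a₂ ++ b₁ ++ b₂)
    (hS : (Q.src a = u ∧ Q.tgt a = v) ∨ (Q.src a = v ∧ Q.tgt a = u)) :
    Q.EquivZero c2 (x ++ a₁ ++ y ++ a₂ ++ x ++ b₁ ++ y ++ b₂) := by
  have s1 := zero_swap hc u (x ++ a₁ ++ y) a₂ (x ++ b₁ ++ y) b₂
    (path_append (path_append hx ha1) hy) ha2 (path_append (path_append hx hb1) hy) hb2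
  simp only [List.append_assoc] at s1 ⊢
  refine s1 ?_
  have e : x ++ (a₁ ++ (y ++ (x ++ (b₁ ++ (y ++ (a₂ ++ b₂))))))
    = x ++ (a₁ ++ y ++ x ++ b₁ ++ y ++ (a₂ ++ b₂)) := by simp
  rw [e]
  refine zero_rot hx (path_append (path_append (path_append (path_append
    (path_append ha1 hy) hx) hb1) hy) (path_append ha2 hb2)) ?_
  have s2 := zero_swap hc v a₁ (y ++ x) b₁ (y ++ (a₂ ++ b₂) ++ x)
    ha1 (path_append hy hx) hb1 (path_append (path_append hy (path_append ha2 hb2)) hx)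
  simp only [List.append_assoc] at s2 ⊢
  refine s2 ?_
  have e : a₁ ++ (b₁ ++ (y ++ (x ++ (y ++ (a₂ ++ (b₂ ++ x))))))
    = (a₁ ++ b₁ ++ y ++ x ++ y ++ (a₂ ++ b₂)) ++ x := by simp
  rw [e]
  refine zero_rot (path_append (path_append (path_append (path_append
    (path_append ha1 hb1) hy) hx) hy) (path_append ha2 hb2)) hx ?_
  have := zero_core' hc huv hx hy (path_append ha1 hb1) (path_append ha2 hb2) hne hne' (a := a)
    (by simp only [List.mem_append] at ha ⊢; tauto) hS
  simpa using this

/-- Non-alternating case `x a₁ y a₂ y a₃ x b`. -/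
theorem zero_nonalt {Q : QuiverData} {c2 : Prop} (hc : c2) {u v : Q.V} (huv : u ≠ v)
    {x y a₁ a₂ a₃ b : List Q.A}
    (hx : Q.IsPathFrom u v x) (hy : Q.IsPathFrom v u y) (ha1 : Q.IsPathFrom v v a₁)
    (ha2 : Q.IsPathFrom u v a₂) (ha3 : Q.IsPathFrom u u a₃) (hb : Q.IsPathFrom v u b)
    (hne : x ≠ []) (hne' : y ≠ []) {a : Q.A} (ha : a ∈ a₁ ++ a₂ ++ a₃ ++ b)
    (hS : (Q.src a = u ∧ Q.tgt a = v) ∨ (Q.src a = v ∧ Q.tgt a = u)) :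
    Q.EquivZero c2 (x ++ a₁ ++ y ++ a₂ ++ y ++ a₃ ++ x ++ b) := by
  have s1 := zero_swap hc u (x ++ a₁ ++ y) (a₂ ++ y ++ a₃) (x ++ b) []
    (path_append (path_append hx ha1) hy) (path_append (path_append ha2 hy) ha3)
    (path_append hx hb) rfl
  simp only [List.append_assoc, List.append_nil] at s1 ⊢
  refine s1 ?_
  have := zero_alt hc huv hx hy ha1 (a₂ := []) rfl (path_append hb ha2) ha3 hne hne' (a := a)
    (by simp only [List.mem_append] at ha ⊢; tauto) hS
  simpa using this

theorem card_get_eq {α : Type} (P : α → Prop) [DecidablePred P] (l : List α) :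
    Nat.card {i : Fin l.length // P (l.get i)} = l.countP (fun a => decide (P a)) := by
  rw [Nat.card_eq_fintype_card, Fintype.card_subtype]
  induction l with
  | nil => simp
  | cons a l ih =>
    rw [List.countP_cons, ← ih]
    simp only [List.length_cons]
    rw [Fin.card_filter_univ_succ]
    by_cases h : P a <;> simp [h]

end QuiverData

open QuiverData in
theorem two_vertex_zero_aux
    {c2 : Prop} (hc : c2)
    (Q : QuiverData) (u v : Q.V) (huv : u ≠ v)
    (w₀ : Q.V) (h : List Q.A) (hcl : Q.IsPathFrom w₀ w₀ h)
    (x₁ y₁ : Q.A)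
    (hx₁ : Q.src x₁ = u ∧ Q.tgt x₁ = v) (hy₁ : Q.src y₁ = v ∧ Q.tgt y₁ = u)
    (hx₁2 : 2 ≤ h.countP (fun a => decide (a = x₁)))
    (hy₁2 : 2 ≤ h.countP (fun a => decide (a = y₁)))
    (S : Set Q.A) (hSdef : ∀ a, a ∈ S ↔
      ((Q.src a = u ∧ Q.tgt a = v) ∨ (Q.src a = v ∧ Q.tgt a = u)))
    (htot : 4 < h.countP (fun a => decide (a ∈ S))) :
    Q.EquivZero c2 h := by
  have hxy : x₁ ≠ y₁ := by
    rintro rfl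
    exact huv (hx₁.1.symm.trans hy₁.1)
  have hX : Q.IsPathFrom u v [x₁] := ⟨hx₁.1, hx₁.2⟩
  have hY : Q.IsPathFrom v u [y₁] := ⟨hy₁.1, hy₁.2⟩
  have hxS : x₁ ∈ S := (hSdef _).2 (Or.inl hx₁)
  have hyS : y₁ ∈ S := (hSdef _).2 (Or.inr hy₁)
  have mem_of : ∀ (b : Q.A) (l : List Q.A), 0 < l.countP (fun a => decide (a = b)) → b ∈ l := by
    intro b l hl
    obtain ⟨a, ha, hb⟩ := List.countP_pos_iff.1 hl
    have : a = b := by simpa using hb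
    exact this ▸ ha
  have memS : ∀ (l : List Q.A), 0 < l.countP (fun a => decide (a ∈ S)) → ∃ a ∈ l, a ∈ S := by
    intro l hl
    obtain ⟨a, ha, hb⟩ := List.countP_pos_iff.1 hl
    exact ⟨a, ha, by simpa using hb⟩
  obtain ⟨s, t, rfl⟩ := List.append_of_mem (mem_of x₁ h (by omega))
  obtain ⟨hs, ht⟩ := path_split_cons hcl
  rw [hx₁.1] at hs
  rw [hx₁.2] at ht
  refine zero_rot hs (b := x₁ :: t) ⟨hx₁.1, by rw [hx₁.2]; exact ht⟩ ?_
  have hts : Q.IsPathFrom v u (t ++ s) := path_append ht hs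
  have hm : x₁ ∈ t ++ s := by
    apply mem_of
    simp only [List.countP_append, List.countP_cons, decide_true, if_true] at hx₁2 ⊢
    omega
  have cy : 2 ≤ (t ++ s).countP (fun a => decide (a = y₁)) := by
    simp [List.countP_append, hxy] at hy₁2 ⊢
    omega
  have cS : 4 ≤ (t ++ s).countP (fun a => decide (a ∈ S)) := by
    simp only [List.countP_append, List.countP_cons, hxS, decide_true, if_true] at htot ⊢
    omega
  rw [List.cons_append]
  generalize t ++ s = g at *
  obtain ⟨A, B, rfl⟩ := List.append_of_mem hm
  obtain ⟨hA, hB⟩ := path_split_cons hts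
  rw [hx₁.1] at hA
  rw [hx₁.2] at hB
  have cy : 2 ≤ A.countP (fun a => decide (a = y₁)) + B.countP (fun a => decide (a = y₁)) := by
    simp [List.countP_append, hxy] at cy ⊢
    omega
  have cS : 3 ≤ A.countP (fun a => decide (a ∈ S)) + B.countP (fun a => decide (a ∈ S)) := by
    simp only [List.countP_append, List.countP_cons, hxS, decide_true, if_true] at cS ⊢
    omega
  clear hx₁2 hy₁2 htot hts hm
  -- both occurrences of `y₁` in the same segment
  have two : ∀ A B : List Q.A, Q.IsPathFrom v u A → Q.IsPathFrom v u B →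
      2 ≤ A.countP (fun a => decide (a = y₁)) →
      3 ≤ A.countP (fun a => decide (a ∈ S)) + B.countP (fun a => decide (a ∈ S)) →
      Q.EquivZero c2 (x₁ :: (A ++ x₁ :: B)) := by
    intro A B hA hB c1 c2'
    obtain ⟨a₁, A', rfl⟩ := List.append_of_mem (mem_of y₁ A (by omega))
    obtain ⟨ha1, hA'⟩ := path_split_cons hA
    have : y₁ ∈ a₁ ∨ y₁ ∈ A' := by
      rw [← List.mem_append]
      apply mem_of
      simp only [List.countP_append, List.countP_cons, decide_true, if_true] at c1 ⊢
      omega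
    have key : ∃ a₁' a₂ a₃, a₁ ++ y₁ :: A' = a₁' ++ y₁ :: (a₂ ++ y₁ :: a₃) := by
      rcases this with h' | h'
      · obtain ⟨p, q, rfl⟩ := List.append_of_mem h'
        exact ⟨p, q, A', by simp⟩
      · obtain ⟨p, q, rfl⟩ := List.append_of_mem h'
        exact ⟨a₁, p, q, rfl⟩
    obtain ⟨b₁, b₂, b₃, e⟩ := key
    rw [e] at hA c2' ⊢
    obtain ⟨h1, h2⟩ := path_split_cons hA
    obtain ⟨h2, h3⟩ := path_split_cons h2
    rw [hy₁.1] at h1 h2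
    rw [hy₁.2] at h2 h3
    obtain ⟨a, ha, haS⟩ := memS (b₁ ++ b₂ ++ b₃ ++ B) (by
      simp only [List.countP_append, List.countP_cons, hyS, decide_true, if_true] at c2' ⊢
      omega)
    have := zero_nonalt hc huv hX hY h1 h2 h3 hB (by simp) (by simp) ha ((hSdef _).1 haS)
    simpa using this
  by_cases h1 : 2 ≤ A.countP (fun a => decide (a = y₁))
  · exact two A B hA hB h1 cS
  by_cases h2 : 2 ≤ B.countP (fun a => decide (a = y₁))
  · have := zero_rot (path_append hX hA) (path_append hX hB) (c2 := c2)
      (by simpa using two B A hB hA h2 (by omega))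
    simpa using this
  obtain ⟨a₁, a₂, rfl⟩ := List.append_of_mem (mem_of y₁ A (by omega))
  obtain ⟨b₁, b₂, rfl⟩ := List.append_of_mem (mem_of y₁ B (by omega))
  obtain ⟨ha1, ha2⟩ := path_split_cons hA
  obtain ⟨hb1, hb2⟩ := path_split_cons hB
  rw [hy₁.1] at ha1 hb1
  rw [hy₁.2] at ha2 hb2
  obtain ⟨a, ha, haS⟩ := memS (a₁ ++ a₂ ++ b₁ ++ b₂) (by
    simp only [List.countP_append, List.countP_cons, hyS, decide_true, if_true] at cS ⊢
    omega)
  have := zero_alt hc huv hX hY ha1 ha2 hb1 hb2 (by simp) (by simp) ha ((hSdef _).1 haS)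
  simpa using this

/-- **Lemma (two-vertex quiver, part b).** Let `char K = 2` and let `Q` be a quiver
with exactly two vertices `u ≠ v`, with loop sets `P` (at `u`), `R` (at `v`) and
arrow sets `X` (from `u` to `v`), `Y` (from `v` to `u`).  Let `h` be a closed path
such that some `x₁ ∈ X` occurs at least twice in `h`, some `y₁ ∈ Y` occurs at least
twice in `h`, and the total number of occurrences in `h` of arrows from `X ∪ Y` is
strictly greater than `4`.  Then `h ≡ (x₁y₁)²f` for some path `f`. -/
theorem two_vertex_square_factor
    (K : Type) [Field K] [Infinite K] (hchar : ringChar K = 2)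
    (Q : QuiverData) (u v : Q.V) (huv : u ≠ v) (hall : ∀ z : Q.V, z = u ∨ z = v)
    (w₀ : Q.V) (h : List Q.A) (hcl : Q.IsClosedAt w₀ h)
    (x₁ y₁ : Q.A)
    (hx₁ : Q.src x₁ = u ∧ Q.tgt x₁ = v) (hy₁ : Q.src y₁ = v ∧ Q.tgt y₁ = u)
    (hx₁2 : 2 ≤ Q.adeg h x₁) (hy₁2 : 2 ≤ Q.adeg h y₁)
    (htot : 4 < Q.sdeg h
      {a | (Q.src a = u ∧ Q.tgt a = v) ∨ (Q.src a = v ∧ Q.tgt a = u)}) :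
    ∃ f : List Q.A, f ≠ [] ∧ Q.IsPathFrom u u f ∧
      Q.PathEquiv (ringChar K = 2) h (x₁ :: y₁ :: x₁ :: y₁ :: f) := by
  have hz : Q.EquivZero (ringChar K = 2) h := by
    refine two_vertex_zero_aux hchar Q u v huv w₀ h hcl.2 x₁ y₁ hx₁ hy₁ ?_ ?_
      {a | (Q.src a = u ∧ Q.tgt a = v) ∨ (Q.src a = v ∧ Q.tgt a = u)} (fun a => Iff.rfl) ?_
    · rw [← QuiverData.card_get_eq (fun a => a = x₁)]; exact hx₁2
    · rw [← QuiverData.card_get_eq (fun a => a = y₁)]; exact hy₁2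
    · have := htot
      unfold QuiverData.sdeg at this
      rw [QuiverData.card_get_eq (fun a => a ∈
        {a | (Q.src a = u ∧ Q.tgt a = v) ∨ (Q.src a = v ∧ Q.tgt a = u)})] at this
      convert this
  have hp : Q.IsPathFrom u u [x₁, y₁] := ⟨hx₁.1, hy₁.1.trans hx₁.2.symm, hy₁.2⟩
  have hcl' : Q.IsClosedAt u [x₁, y₁] := ⟨by simp, hp⟩
  refine ⟨[x₁, y₁], by simp, hp, ?_⟩
  exact QuiverData.PEquiv.trans hz
    (QuiverData.PEquiv.sq_mul u [x₁, y₁] [x₁, y₁] false hcl' hcl').symm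
end

section
/- Let K be an infinite field with char(K) = 2, Q a quiver containing a path a = a_1⋯a_s with a_1,…,a_s ∈ Q_1 pairwise different, and let h be a closed path in Q such that each a_i occurs at least twice in h and some arrow b occurring in h is different from all a_i. Then h ≡ a_1⋯a_s · f for some possibly empty path f. Moreover: (a) if the head of b equals the tail of a_1, then h ≡ b · a_1⋯a_s · f for some possibly empty path f; (b) if the tail of b equals the head of a_s, then h ≡ a_1⋯a_s · b · f for some possibly empty path f. -/
open Classical BigOperators

namespace QuiverData

variable {Q : QuiverData}

theorem isPath_append {u v : Q.V} {l m : List Q.A} :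
    Q.IsPathFrom u v (l ++ m) ↔ ∃ t, Q.IsPathFrom u t l ∧ Q.IsPathFrom t v m := by
  induction l generalizing u with
  | nil => simp [IsPathFrom]
  | cons a l ih => simp [IsPathFrom, ih, and_assoc]

theorem adeg_eq_count (l : List Q.A) (b : Q.A) : Q.adeg l b = l.count b := by
  unfold adeg
  rw [Nat.card_eq_fintype_card, Fintype.card_subtype]
  have h1 : (Finset.univ.val.map l.get : Multiset Q.A) = (l : Multiset Q.A) := by
    simp [Fin.univ_def]
  rw [← Multiset.coe_count, ← h1, Multiset.count_map]
  simp only [Finset.card, Finset.filter_val, eq_comm]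

theorem split_two {a : Q.A} {f : List Q.A} (h : 2 ≤ f.count a) :
    ∃ x y z, f = x ++ a :: (y ++ a :: z) := by
  have h1 : a ∈ f := List.count_pos_iff.1 (by omega)
  obtain ⟨x, r, rfl, hx⟩ := List.eq_append_cons_of_mem h1
  have h2 : a ∈ r := by
    rw [List.count_append, List.count_eq_zero_of_not_mem hx, List.count_cons_self] at h
    exact List.count_pos_iff.1 (by omega)
  obtain ⟨y, z, rfl⟩ := List.append_of_mem h2
  exact ⟨x, y, z, rfl⟩

theorem path_cyc {c2 : Prop} {u v : Q.V} {a b : List Q.A} (ha : Q.IsPathFrom u v a)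
    (hb : Q.IsPathFrom v u b) : Q.PathEquiv c2 (a ++ b) (b ++ a) := by
  by_cases h : a ++ b = []
  · simp only [List.append_eq_nil_iff] at h
    rw [h.1, h.2]
    exact PEquiv.refl _
  · exact PEquiv.cyc u v a b false ha hb h

theorem path_swap {c2 : Prop} (h2 : c2) {v : Q.V} {w₁ c d w₂ : List Q.A}
    (h₁ : Q.IsPathFrom v v w₁) (hc : Q.IsPathFrom v v c) (hd : Q.IsPathFrom v v d)
    (h₂ : Q.IsPathFrom v v w₂) :
    Q.PathEquiv c2 (w₁ ++ c ++ d ++ w₂) (w₁ ++ d ++ c ++ w₂) := by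
  by_cases hc0 : c = []
  · subst hc0; simpa [PathEquiv] using PEquiv.refl _
  by_cases hd0 : d = []
  · subst hd0; simpa [PathEquiv] using PEquiv.refl _
  have := PEquiv.swap (c2 := c2) v w₁ c d w₂ false h₁ ⟨hc0, hc⟩ ⟨hd0, hd⟩ h₂
  rwa [if_pos h2] at this

theorem step_app {c2 : Prop} (h2 : c2) {p q : Q.V} {C f : List Q.A} {a : Q.A}
    (hC : Q.IsPathFrom p q C) (hf : Q.IsPathFrom q p f) (ha : Q.src a = q)
    (hn : 2 ≤ f.count a) :
    ∃ f', Q.IsPathFrom (Q.tgt a) p f' ∧ Q.PathEquiv c2 (C ++ f) (C ++ a :: f') ∧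
      f.Perm (a :: f') := by
  obtain ⟨x, y, z, rfl⟩ := split_two hn
  obtain ⟨t, hx, h3⟩ := isPath_append.1 hf
  obtain ⟨rfl, h3⟩ := h3
  obtain ⟨t, hy, h4⟩ := isPath_append.1 h3
  obtain ⟨rfl, hz⟩ := h4
  subst ha
  refine ⟨y ++ x ++ a :: z, ?_, ?_, ?_⟩
  · exact isPath_append.2 ⟨_, isPath_append.2 ⟨_, hy, hx⟩, rfl, hz⟩
  · refine (path_cyc hC hf).trans ?_
    have h5 : Q.IsPathFrom (Q.src a) (Q.src a) (a :: (y ++ x ++ a :: z) ++ C) :=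
      isPath_append.2 ⟨_, ⟨rfl, isPath_append.2 ⟨_, isPath_append.2 ⟨_, hy, hx⟩, rfl, hz⟩⟩, hC⟩
    have h6 := path_swap (Q := Q) h2 (v := Q.src a) (w₁ := []) (c := x) (d := a :: y)
      (w₂ := a :: z ++ C) rfl hx ⟨rfl, hy⟩ (isPath_append.2 ⟨_, ⟨rfl, hz⟩, hC⟩)
    have h7 := path_cyc (c2 := c2) (Q := Q) (a := a :: (y ++ x ++ a :: z)) (b := C) (u := Q.src a)
      (v := p) ⟨rfl, isPath_append.2 ⟨_, isPath_append.2 ⟨_, hy, hx⟩, rfl, hz⟩⟩ hC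
    simp only [List.nil_append, List.append_assoc, List.cons_append] at h6 h7 ⊢
    exact h6.trans h7
  · rw [List.perm_iff_count]
    intro c
    simp only [List.count_append, List.count_cons]
    omega

theorem step_pre {c2 : Prop} (h2 : c2) {p q : Q.V} {C f : List Q.A} {a : Q.A}
    (hC : Q.IsPathFrom p q C) (hf : Q.IsPathFrom q p f) (ha : Q.tgt a = p)
    (hn : 2 ≤ f.count a) :
    ∃ f', Q.IsPathFrom q (Q.src a) f' ∧ Q.PathEquiv c2 (C ++ f) (a :: C ++ f') ∧
      f.Perm (a :: f') := by
  obtain ⟨x, y, z, rfl⟩ := split_two hn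
  obtain ⟨t, hx, h3⟩ := isPath_append.1 hf
  obtain ⟨rfl, h3⟩ := h3
  obtain ⟨t, hy, h4⟩ := isPath_append.1 h3
  obtain ⟨rfl, hz⟩ := h4
  subst ha
  have hf' : Q.IsPathFrom q (Q.src a) (x ++ a :: (z ++ y)) :=
    isPath_append.2 ⟨_, hx, rfl, isPath_append.2 ⟨_, hz, hy⟩⟩
  have hone : Q.IsPathFrom (Q.src a) (Q.tgt a) [a] := ⟨rfl, rfl⟩
  refine ⟨x ++ a :: (z ++ y), hf', ?_, ?_⟩
  · have h6 := path_swap (Q := Q) h2 (v := Q.tgt a) (w₁ := C ++ (x ++ [a])) (c := y ++ [a])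
      (d := z) (w₂ := []) (isPath_append.2 ⟨_, hC, isPath_append.2 ⟨_, hx, hone⟩⟩)
      (isPath_append.2 ⟨_, hy, hone⟩) hz rfl
    have h7 := path_cyc (c2 := c2) (Q := Q) (isPath_append.2 ⟨_, hC, hf'⟩) hone
    simp only [List.nil_append, List.append_nil, List.append_assoc, List.cons_append] at h6 h7 ⊢
    exact h6.trans h7
  · rw [List.perm_iff_count]
    intro c
    simp only [List.count_append, List.count_cons]
    omega

theorem pull_app {c2 : Prop} (h2 : c2) {p q r : Q.V} {C f l : List Q.A}
    (hC : Q.IsPathFrom p q C) (hf : Q.IsPathFrom q p f) (hl : Q.IsPathFrom q r l)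
    (hnd : l.Nodup) (hn : ∀ x ∈ l, 2 ≤ f.count x) :
    ∃ f', Q.IsPathFrom r p f' ∧ Q.PathEquiv c2 (C ++ f) (C ++ l ++ f') := by
  induction l generalizing C f q with
  | nil =>
    obtain rfl : q = r := hl
    exact ⟨f, hf, by simpa [PathEquiv] using PEquiv.refl _⟩
  | cons a l ih =>
    obtain ⟨ha, hl⟩ := hl
    obtain ⟨f1, hf1, he1, hp⟩ := step_app h2 hC hf ha (hn a (by simp))
    rw [List.nodup_cons] at hnd
    obtain ⟨f2, hf2, he2⟩ := ih (C := C ++ [a])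
      (isPath_append.2 ⟨_, hC, ha, rfl⟩) hf1 hl hnd.2 (by
        intro x hx
        have h1 := hn x (by simp [hx])
        have hne : a ≠ x := fun h => hnd.1 (h ▸ hx)
        rwa [hp.count_eq, List.count_cons_of_ne hne] at h1)
    refine ⟨f2, hf2, he1.trans ?_⟩
    simpa [PathEquiv] using he2

theorem pull_pre {c2 : Prop} (h2 : c2) {p q r : Q.V} {C f l : List Q.A}
    (hC : Q.IsPathFrom p q C) (hf : Q.IsPathFrom q p f) (hl : Q.IsPathFrom r p l)
    (hnd : l.Nodup) (hn : ∀ x ∈ l, 2 ≤ f.count x) :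
    ∃ f', Q.IsPathFrom q r f' ∧ Q.PathEquiv c2 (C ++ f) (l ++ C ++ f') := by
  induction l using List.reverseRecOn generalizing C f p with
  | nil =>
    obtain rfl : r = p := hl
    exact ⟨f, hf, by simpa [PathEquiv] using PEquiv.refl _⟩
  | append_singleton l a ih =>
    obtain ⟨t, hl1, rfl, ha⟩ := isPath_append.1 hl
    obtain ⟨f1, hf1, he1, hp⟩ := step_pre h2 hC hf ha (hn a (by simp))
    obtain ⟨hnd1, -, hdis⟩ := List.nodup_append.1 hnd
    obtain rfl : Q.tgt a = p := ha
    obtain ⟨f2, hf2, he2⟩ := ih (C := a :: C)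
      ⟨rfl, hC⟩ hf1 hl1 hnd1 (by
        intro x hx
        have h1 := hn x (by simp [hx])
        have hne : a ≠ x := fun h => hdis x hx a (by simp) h.symm
        rwa [hp.count_eq, List.count_cons_of_ne hne] at h1)
    refine ⟨f2, hf2, he1.trans ?_⟩
    simpa [PathEquiv] using he2

/-- Rotate a closed path so that it starts with a given arrow. -/
theorem rotate_to_s15 {c2 : Prop} {v : Q.V} {h : List Q.A} {b : Q.A} (hv : Q.IsPathFrom v v h)
    (hb : b ∈ h) : ∃ f, Q.IsPathFrom (Q.tgt b) (Q.src b) f ∧ Q.PathEquiv c2 h ([b] ++ f) ∧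
      h.Perm (b :: f) := by
  obtain ⟨x, y, rfl⟩ := List.append_of_mem hb
  obtain ⟨t, hx, rfl, hy⟩ := isPath_append.1 hv
  refine ⟨y ++ x, isPath_append.2 ⟨_, hy, hx⟩, ?_, ?_⟩
  · have := path_cyc (c2 := c2) (Q := Q) (b := b :: y) hx ⟨rfl, hy⟩
    simpa using this
  · rw [List.perm_iff_count]
    intro c
    simp only [List.count_append, List.count_cons]
    omega

end QuiverData

/-- **Lemma (pulling out a path).** Let `char K = 2`, let `Q` contain a path
`a = a₁⋯a_s` with `a₁, …, a_s` pairwise different arrows, and let `h` be a closed path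
such that each `aᵢ` occurs at least twice in `h` and some arrow `b` occurring in `h`
is different from all `aᵢ`.  Then `h ≡ a₁⋯a_s·f` for some possibly empty path `f`;
moreover: (a) if `b' = a₁''` then `h ≡ b·a₁⋯a_s·f`, and (b) if `b'' = a_s'` then
`h ≡ a₁⋯a_s·b·f`, for some possibly empty path `f`. -/
theorem pull_out_path
    (K : Type) [Field K] [Infinite K] (hchar : ringChar K = 2)
    (Q : QuiverData) (u w : Q.V) (al : List Q.A)
    (hal : Q.IsPathFrom u w al) (halne : al ≠ []) (hnodup : al.Nodup)
    (w₀ : Q.V) (h : List Q.A) (hcl : Q.IsClosedAt w₀ h)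
    (htwice : ∀ x ∈ al, 2 ≤ Q.adeg h x)
    (b : Q.A) (hb : b ∈ h) (hbal : b ∉ al) :
    (∃ f : List Q.A, Q.IsPathFrom w u f ∧
      Q.PathEquiv (ringChar K = 2) h (al ++ f)) ∧
    (Q.tgt b = u → ∃ f : List Q.A, Q.IsPathFrom w (Q.src b) f ∧
      Q.PathEquiv (ringChar K = 2) h (b :: al ++ f)) ∧
    (Q.src b = w → ∃ f : List Q.A, Q.IsPathFrom (Q.tgt b) u f ∧
      Q.PathEquiv (ringChar K = 2) h (al ++ b :: f)) := by
  simp only [QuiverData.adeg_eq_count] at htwice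
  obtain ⟨f, hf, he, hp⟩ := QuiverData.rotate_to_s15 (c2 := ringChar K = 2) hcl.2 hb
  have hbb : Q.IsPathFrom (Q.src b) (Q.tgt b) [b] := ⟨rfl, rfl⟩
  have hn : ∀ x ∈ al, 2 ≤ f.count x := by
    intro x hx
    have h1 := htwice x hx
    have hne : b ≠ x := fun h => hbal (h ▸ hx)
    rwa [hp.count_eq, List.count_cons_of_ne hne] at h1
  refine ⟨?_, ?_, ?_⟩
  · cases al with
    | nil => exact absurd rfl halne
    | cons a l =>
      obtain ⟨rfl, hl⟩ := hal
      have ha : a ∈ h := List.count_pos_iff.1 (by have := htwice a (by simp); omega)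
      obtain ⟨g, hg, he', hp'⟩ := QuiverData.rotate_to_s15 (c2 := ringChar K = 2) hcl.2 ha
      rw [List.nodup_cons] at hnodup
      obtain ⟨g', hg', he''⟩ := QuiverData.pull_app hchar (C := [a]) ⟨rfl, rfl⟩ hg hl hnodup.2 (by
        intro x hx
        have h1 := htwice x (by simp [hx])
        have hne : a ≠ x := fun h => hnodup.1 (h ▸ hx)
        rwa [hp'.count_eq, List.count_cons_of_ne hne] at h1)
      exact ⟨g', hg', he'.trans he''⟩
  · rintro rfl
    obtain ⟨g, hg, he'⟩ := QuiverData.pull_app hchar hbb hf hal hnodup hn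
    exact ⟨g, hg, he.trans he'⟩
  · rintro rfl
    obtain ⟨g, hg, he'⟩ := QuiverData.pull_pre hchar hbb hf hal hnodup hn
    refine ⟨g, hg, he.trans ?_⟩
    simpa [QuiverData.PathEquiv] using he'
end

section
/- Let K be an infinite field with char(K) = 2, Q a quiver, and a = a_1⋯a_s a primitive closed path in Q with a_1,…,a_s ∈ Q_1 pairwise different and s ≥ 2; set v_i = tail of a_i for 1 ≤ i ≤ s. Let h be a closed path in Q such that each a_i occurs at least twice in h, and suppose some arrow b occurring in h satisfies b ≠ a_i for all i, the head of b differs from the tail of b, and {head of b, tail of b} ⊆ {v_2, v_k} for some k ∈ {1, 3, 4, …, s}. Then h ≡ a_1 a_2 f_1 a_1 a_2 f_2 for some possibly empty paths f_1, f_2. -/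
open Classical BigOperators

namespace RIS

variable {Q : QuiverData}

theorem path_append {u w : Q.V} {x y : List Q.A} :
    Q.IsPathFrom u w (x ++ y) ↔ ∃ t, Q.IsPathFrom u t x ∧ Q.IsPathFrom t w y := by
  induction x generalizing u with
  | nil => simp [QuiverData.IsPathFrom]
  | cons c x ih => simp [QuiverData.IsPathFrom, ih, and_assoc]

theorem path_trans {u t w : Q.V} {x y : List Q.A}
    (hx : Q.IsPathFrom u t x) (hy : Q.IsPathFrom t w y) : Q.IsPathFrom u w (x ++ y) :=
  path_append.2 ⟨t, hx, hy⟩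

/-- The path `l` from `p` to `p` visits `u`. -/
def Visits (p u : Q.V) (l : List Q.A) : Prop :=
  ∃ x y, l = x ++ y ∧ Q.IsPathFrom p u x ∧ Q.IsPathFrom u p y

theorem split_at {u w : Q.V} {l : List Q.A} (hl : Q.IsPathFrom u w l) {c : Q.A} (hc : c ∈ l) :
    ∃ s t, l = s ++ c :: t ∧ Q.IsPathFrom u (Q.src c) s ∧ Q.IsPathFrom (Q.tgt c) w t := by
  obtain ⟨s, t, rfl⟩ := List.append_of_mem hc
  obtain ⟨p, h1, h2, h3⟩ := path_append.1 hl
  subst h2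
  exact ⟨s, t, rfl, h1, h3⟩

theorem visits_src {p : Q.V} {l : List Q.A} (hl : Q.IsPathFrom p p l) {c : Q.A} (hc : c ∈ l) :
    Visits p (Q.src c) l := by
  obtain ⟨s, t, rfl, h1, h2⟩ := split_at hl hc
  exact ⟨s, c :: t, rfl, h1, rfl, h2⟩

theorem visits_tgt {p : Q.V} {l : List Q.A} (hl : Q.IsPathFrom p p l) {c : Q.A} (hc : c ∈ l) :
    Visits p (Q.tgt c) l := by
  obtain ⟨s, t, rfl, h1, h2⟩ := split_at hl hc
  exact ⟨s ++ [c], t, by simp, path_trans h1 ⟨rfl, rfl⟩, h2⟩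

theorem ne_nil_of_path {u w : Q.V} {l : List Q.A} (hl : Q.IsPathFrom u w l) (h : u ≠ w) :
    l ≠ [] := by
  rintro rfl
  exact h hl

theorem cyc' (c2 : Prop) {u w : Q.V} {x y : List Q.A} (hx : Q.IsPathFrom u w x)
    (hy : Q.IsPathFrom w u y) : Q.PathEquiv c2 (x ++ y) (y ++ x) := by
  by_cases h : x ++ y = []
  · simp only [List.append_eq_nil_iff] at h
    rw [h.1, h.2]
    exact .refl _
  · exact .cyc u w x y false hx hy h

theorem swap' {c2 : Prop} (hc : c2) {t u : Q.V} {x c d y : List Q.A}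
    (hx : Q.IsPathFrom t u x) (h1 : Q.IsPathFrom u u c) (h2 : Q.IsPathFrom u u d)
    (hy : Q.IsPathFrom u t y) :
    Q.PathEquiv c2 (x ++ c ++ d ++ y) (x ++ d ++ c ++ y) := by
  by_cases hcn : c = []
  · subst hcn; simpa [QuiverData.PathEquiv] using QuiverData.PEquiv.refl _
  by_cases hdn : d = []
  · subst hdn; simpa [QuiverData.PathEquiv] using QuiverData.PEquiv.refl _
  have e1 := cyc' c2 hx (path_trans (path_trans h1 h2) hy)
  have e2 := cyc' c2 hx (path_trans (path_trans h2 h1) hy)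
  have e3 := QuiverData.PEquiv.swap (Q := Q) (c2 := c2) u [] c d (y ++ x) false rfl
    ⟨hcn, h1⟩ ⟨hdn, h2⟩ (path_trans hy hx)
  rw [if_pos hc] at e3
  unfold QuiverData.PathEquiv at *
  simp only [List.append_assoc, List.nil_append] at *
  exact e1.trans (e3.trans e2.symm)

theorem perm_flatten {c2 : Prop} (hc : c2) {p : Q.V} {L M : List (List Q.A)} (hp : L.Perm M)
    (w : List Q.A) (hw : Q.IsPathFrom p p w) (hL : ∀ l ∈ L, Q.IsPathFrom p p l) :
    Q.PathEquiv c2 (w ++ L.flatten) (w ++ M.flatten) := by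
  have flat : ∀ L : List (List Q.A), (∀ l ∈ L, Q.IsPathFrom p p l) →
      Q.IsPathFrom p p L.flatten := by
    intro L
    induction L with
    | nil => intro _; rfl
    | cons a L ih =>
      intro h
      exact path_trans (h a (by simp)) (ih fun l hl => h l (by simp [hl]))
  induction hp generalizing w with
  | nil => exact .refl _
  | cons a _ ih =>
    have := ih (w ++ a) (path_trans hw (hL a (by simp))) (fun l hl => hL l (by simp [hl]))
    simpa using this
  | swap a b l =>
    have := swap' hc hw (hL b (by simp)) (hL a (by simp)) (flat l fun m hm => hL m (by simp [hm]))
    simpa using this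
  | trans h1 h2 ih1 ih2 =>
    exact (ih1 w hw hL).trans (ih2 w hw fun l hl => hL l (h1.mem_iff.2 hl))

theorem flat_path {p : Q.V} : ∀ L : List (List Q.A), (∀ l ∈ L, Q.IsPathFrom p p l) →
      Q.IsPathFrom p p L.flatten := by
  intro L
  induction L with
  | nil => intro _; rfl
  | cons a L ih =>
    intro h
    exact path_trans (h a (by simp)) (ih fun l hl => h l (by simp [hl]))

/-- First-return loops at `p`. -/
def FR (p : Q.V) (l : List Q.A) : Prop :=
  l ≠ [] ∧ Q.IsPathFrom p p l ∧ ∀ x y, l = x ++ y → Q.IsPathFrom p p x → Q.IsPathFrom p p y →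
    x = [] ∨ y = []

theorem fr_decomp (p : Q.V) : ∀ (n : ℕ) (l : List Q.A), l.length ≤ n → Q.IsPathFrom p p l →
    ∃ L : List (List Q.A), l = L.flatten ∧ ∀ m ∈ L, FR p m := by
  intro n
  induction n with
  | zero =>
    intro l hl _
    exact ⟨[], by simpa using hl, by simp⟩
  | succ n ih =>
    intro l hl hp
    by_cases hn : l = []
    · exact ⟨[], by simpa using hn, by simp⟩
    by_cases hf : FR p l
    · exact ⟨[l], by simp, by simpa using hf⟩
    · simp only [FR, not_and, not_forall, not_or] at hf
      obtain ⟨x, y, rfl, hx, hy, hxn, hyn⟩ := hf hn hp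
      have := List.length_pos_iff.2 hxn
      have := List.length_pos_iff.2 hyn
      simp only [List.length_append] at hl
      obtain ⟨L, rfl, hL⟩ := ih x (by omega) hx
      obtain ⟨M, rfl, hM⟩ := ih y (by omega) hy
      refine ⟨L ++ M, by simp, ?_⟩
      intro m hm
      rcases List.mem_append.1 hm with h | h
      · exact hL m h
      · exact hM m h

theorem fr_src {p : Q.V} {l : List Q.A} (hl : FR p l) {s t : List Q.A} {c : Q.A}
    (h : l = s ++ c :: t) (hc : Q.src c = p) : s = [] := by
  have hp := hl.2.1
  rw [h] at hp
  obtain ⟨u, h1, h2, h3⟩ := path_append.1 hp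
  rw [hc] at h2
  subst h2
  rcases hl.2.2 s (c :: t) h h1 ⟨hc, h3⟩ with h | h
  · exact h
  · simp at h

theorem fr_tgt {p : Q.V} {l : List Q.A} (hl : FR p l) {s t : List Q.A} {c : Q.A}
    (h : l = s ++ c :: t) (hc : Q.tgt c = p) : t = [] := by
  have hp := hl.2.1
  rw [h] at hp
  obtain ⟨u, h1, h2, h3⟩ := path_append.1 hp
  rw [hc] at h3
  rcases hl.2.2 (s ++ [c]) t (by simp [h]) (path_trans h1 ⟨h2, hc⟩) h3 with h | h
  · simp at h
  · exact h

theorem count_src {p : Q.V} {c : Q.A} (hc : Q.src c = p) (L : List (List Q.A))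
    (hL : ∀ m ∈ L, FR p m) :
    List.count c L.flatten = L.countP (fun m => decide (m.head? = some c)) := by
  induction L with
  | nil => simp
  | cons m L ih =>
    rw [List.flatten_cons, List.count_append, ih fun m hm => hL m (by simp [hm]),
      List.countP_cons, add_comm]
    congr 1
    have hm := hL m (by simp)
    cases m with
    | nil => exact absurd rfl hm.1
    | cons d t =>
      have : c ∉ t := by
        intro hct
        obtain ⟨s, r, rfl⟩ := List.append_of_mem hct
        have := fr_src hm (s := d :: s) (t := r) (c := c) (by simp) hc
        simp at this
      simp [List.count_cons, List.count_eq_zero.2 this]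

theorem count_tgt {p : Q.V} {c : Q.A} (hc : Q.tgt c = p) (L : List (List Q.A))
    (hL : ∀ m ∈ L, FR p m) :
    List.count c L.flatten = L.countP (fun m => decide (m.getLast? = some c)) := by
  induction L with
  | nil => simp
  | cons m L ih =>
    rw [List.flatten_cons, List.count_append, ih fun m hm => hL m (by simp [hm]),
      List.countP_cons, add_comm]
    congr 1
    have hm := hL m (by simp)
    rcases List.eq_nil_or_concat m with h | ⟨t, d, rfl⟩
    · exact absurd h hm.1
    · have : c ∉ t := by
        intro hct
        obtain ⟨s, r, rfl⟩ := List.append_of_mem hct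
        have := fr_tgt hm (s := s) (t := r ++ [d]) (c := c) (by simp) hc
        simp at this
      simp [List.count_append, List.count_cons, List.count_eq_zero.2 this]

theorem arrange {α : Type} (S E : α → Bool) (L : List α) (hS : 2 ≤ L.countP S)
    (hE : 2 ≤ L.countP E) :
    (∃ r q r' q' z, L.Perm (r :: q :: r' :: q' :: z) ∧ E r ∧ S q ∧ E r' ∧ S q') ∨
    (∃ r l q z, L.Perm (r :: l :: q :: z) ∧ E r ∧ S l ∧ E l ∧ S q) ∨
    (∃ l l' z, L.Perm (l :: l' :: z) ∧ S l ∧ E l ∧ S l' ∧ E l') := by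
  have h1 := (List.filter_append_perm S L).symm
  have h2 := (List.filter_append_perm E (L.filter S)).symm
  have h3 := (List.filter_append_perm E (L.filter (fun x => !S x))).symm
  have hp := h1.trans (h2.append h3)
  generalize hP : (L.filter S).filter E = P at hp
  generalize hQ : (L.filter S).filter (fun x => !E x) = Q at hp
  generalize hR : (L.filter (fun x => !S x)).filter E = R at hp
  generalize (L.filter (fun x => !S x)).filter (fun x => !E x) = Z at hp
  have kP : ∀ x ∈ P, S x ∧ E x := by
    intro x hx; rw [← hP] at hx; simp at hx; tauto
  have kQ : ∀ x ∈ Q, S x := by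
    intro x hx; rw [← hQ] at hx; simp at hx; tauto
  have kR : ∀ x ∈ R, E x := by
    intro x hx; rw [← hR] at hx; simp at hx; tauto
  have cS : 2 ≤ P.length + Q.length := by
    rw [List.countP_eq_length_filter, h2.length_eq, hP, hQ] at hS
    simpa using hS
  have cE : 2 ≤ P.length + R.length := by
    have : L.countP E = P.length + R.length := by
      rw [h1.countP_eq, List.countP_append, List.countP_eq_length_filter,
        List.countP_eq_length_filter, hP, hR]
    omega
  match P, Q, R with
  | [], q :: q' :: Q, r :: r' :: R =>
    refine Or.inl ⟨r, q, r', q', Q ++ (R ++ Z), hp.trans ?_, ?_⟩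
    · rw [List.perm_iff_count]
      intro a
      simp only [List.count_cons, List.count_append, List.count_nil]
      omega
    · simp_all
  | [l], q :: Q, r :: R =>
    refine Or.inr (Or.inl ⟨r, l, q, Q ++ (R ++ Z), hp.trans ?_, ?_⟩)
    · rw [List.perm_iff_count]
      intro a
      simp only [List.count_cons, List.count_append, List.count_nil]
      omega
    · simp_all
  | l :: l' :: P, Q, R =>
    exact Or.inr (Or.inr ⟨l, l', P ++ Q ++ (R ++ Z), by simpa using hp, by simp_all⟩)
  | [], [], _ => simp at cS
  | [], [_], _ => simp at cS
  | [], _, [] => simp at cE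
  | [], _, [_] => simp at cE
  | [_], [], _ => simp at cS
  | [_], _, [] => simp at cE

/-- The conclusion of the lemma. -/
def Good (c2 : Prop) (a₁ a₂ : Q.A) (h : List Q.A) : Prop :=
  ∃ f₁ f₂ : List Q.A, Q.IsPathFrom (Q.tgt a₂) (Q.src a₁) f₁ ∧
    Q.IsPathFrom (Q.tgt a₂) (Q.src a₁) f₂ ∧
    Q.PathEquiv c2 h (a₁ :: a₂ :: f₁ ++ a₁ :: a₂ :: f₂)

theorem Good.of_equiv {c2 : Prop} {a₁ a₂ : Q.A} {h h' : List Q.A} (hg : Good c2 a₁ a₂ h')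
    (he : Q.PathEquiv c2 h h') : Good c2 a₁ a₂ h := by
  obtain ⟨f₁, f₂, h1, h2, h3⟩ := hg
  exact ⟨f₁, f₂, h1, h2, he.trans h3⟩

theorem good_form {c2 : Prop} {a₁ a₂ : Q.A} {p : Q.V} {X Y W : List Q.A}
    (h : Q.IsPathFrom p p (X ++ (a₁ :: a₂ :: (Y ++ (a₁ :: a₂ :: W))))) :
    Good c2 a₁ a₂ (X ++ (a₁ :: a₂ :: (Y ++ (a₁ :: a₂ :: W)))) := by
  obtain ⟨t, h1, h2⟩ := path_append.1 h
  have h2' := h2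
  obtain ⟨e1, e2, h3⟩ := h2
  obtain ⟨t', h4, e3, e4, h5⟩ := path_append.1 h3
  subst e1 e3
  refine ⟨Y, W ++ X, h4, path_trans h5 h1, ?_⟩
  have := cyc' c2 h1 h2'
  simpa using this

/-- Closed paths at `p` that start with `a₂` and end with `a₁`. -/
def Lp (p : Q.V) (a₁ a₂ : Q.A) (l : List Q.A) : Prop :=
  Q.IsPathFrom p p l ∧ l.head? = some a₂ ∧ l.getLast? = some a₁

theorem head_split {α : Type} {a : α} {x y : List α} (h : (x ++ y).head? = some a) (hx : x ≠ []) :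
    ∃ x0, x = a :: x0 := by
  cases x with
  | nil => exact absurd rfl hx
  | cons b x => exact ⟨x, by simp at h; rw [h]⟩

theorem last_split {α : Type} {a : α} {x y : List α} (h : (x ++ y).getLast? = some a)
    (hy : y ≠ []) : ∃ y0, y = y0 ++ [a] := by
  rcases List.eq_nil_or_concat y with hh | ⟨t, d, rfl⟩
  · exact absurd hh hy
  · refine ⟨t, ?_⟩
    rw [List.concat_eq_append, ← List.append_assoc, List.getLast?_concat] at h
    simp at h
    simp [h]

theorem last_form {α : Type} {a : α} {y : List α} (h : y.getLast? = some a) :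
    ∃ y0, y = y0 ++ [a] := by
  apply last_split (x := []) (by simpa using h)
  rintro rfl
  simp at h

theorem head_form {α : Type} {a : α} {y : List α} (h : y.head? = some a) :
    ∃ y0, y = a :: y0 := by
  apply head_split (y := []) (by simpa using h)
  rintro rfl
  simp at h

/-- If both long loops and the rest visit a common vertex `u ≠ p`, we are done. -/
theorem lemA {c2 : Prop} (hc : c2) {p u : Q.V} (hpu : p ≠ u) {a₁ a₂ : Q.A} {L₁ L₂ Z : List Q.A}
    (h1 : Lp p a₁ a₂ L₁) (h2 : Lp p a₁ a₂ L₂)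
    (v1 : Visits p u L₁) (v2 : Visits p u L₂) (vz : Visits p u Z) :
    Good c2 a₁ a₂ (L₁ ++ L₂ ++ Z) := by
  obtain ⟨x, y, rfl, hx, hy⟩ := v1
  obtain ⟨x', y', rfl, hx', hy'⟩ := v2
  obtain ⟨z, w, rfl, hz, hw⟩ := vz
  obtain ⟨_, hh, hl⟩ := h1
  obtain ⟨_, hh', hl'⟩ := h2
  have e1 : Q.PathEquiv c2 (x ++ (y ++ x') ++ (y' ++ z) ++ w) (x ++ (y' ++ z) ++ (y ++ x') ++ w) :=
    swap' hc hx (path_trans hy hx') (path_trans hy' hz) hw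
  have e2 : Q.PathEquiv c2 ([] ++ (x ++ y') ++ (z ++ y) ++ (x' ++ w))
      ([] ++ (z ++ y) ++ (x ++ y') ++ (x' ++ w)) :=
    swap' hc (t := p) rfl (path_trans hx hy') (path_trans hz hy) (path_trans hx' hw)
  have hp : Q.IsPathFrom p p (z ++ y ++ (x ++ y') ++ (x' ++ w)) :=
    path_trans (path_trans (path_trans hz hy) (path_trans hx hy')) (path_trans hx' hw)
  obtain ⟨x0, rfl⟩ := head_split hh (ne_nil_of_path hx hpu)
  obtain ⟨x0', rfl⟩ := head_split hh' (ne_nil_of_path hx' hpu)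
  obtain ⟨y0, rfl⟩ := last_split hl (ne_nil_of_path hy hpu.symm)
  obtain ⟨y0', rfl⟩ := last_split hl' (ne_nil_of_path hy' hpu.symm)
  have hg := good_form (c2 := c2) (a₁ := a₁) (a₂ := a₂) (p := p) (X := z ++ y0) (Y := x0 ++ y0')
    (W := x0' ++ w) (by simpa using hp)
  apply hg.of_equiv
  unfold QuiverData.PathEquiv at *
  simp only [List.append_assoc, List.cons_append, List.nil_append] at *
  exact e1.trans e2

theorem two_split {α : Type} [DecidableEq α] {c : α} {l : List α} (h : 2 ≤ l.count c) :
    ∃ s q r, l = s ++ c :: (q ++ c :: r) := by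
  induction l with
  | nil => simp at h
  | cons d t ih =>
    by_cases hd : d = c
    · subst hd
      have : d ∈ t := by
        apply List.count_pos_iff.1
        rw [List.count_cons_self] at h
        omega
      obtain ⟨q, r, rfl⟩ := List.append_of_mem this
      exact ⟨[], q, r, rfl⟩
    · rw [List.count_cons_of_ne hd] at h
      obtain ⟨s, q, r, rfl⟩ := ih h
      exact ⟨d :: s, q, r, rfl⟩

/-- Redistribution of a repeated arrow `c` over the two long loops. -/
theorem lemB1 {c2 : Prop} (hc : c2) {p : Q.V} {c a₁ a₂ : Q.A} (hpu : p ≠ Q.src c) (hca : c ≠ a₁)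
    {L₁ L₂ Z : List Q.A}
    (h1 : Lp p a₁ a₂ L₁) (h2 : Lp p a₁ a₂ L₂) (hZ : Q.IsPathFrom p p Z)
    (v2 : Visits p (Q.src c) L₂) (hcnt : 2 ≤ L₁.count c) :
    ∃ M₁ M₂, Lp p a₁ a₂ M₁ ∧ Lp p a₁ a₂ M₂ ∧ c ∈ M₁ ∧ c ∈ M₂ ∧
      (M₁ ++ M₂).Perm (L₁ ++ L₂) ∧ Q.PathEquiv c2 (L₁ ++ L₂ ++ Z) (M₁ ++ M₂ ++ Z) := by
  obtain ⟨hp1, hh, hl⟩ := h1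
  obtain ⟨x, q, r, rfl⟩ := two_split hcnt
  obtain ⟨x', y', rfl, hx', hy'⟩ := v2
  obtain ⟨_, hh', hl'⟩ := h2
  obtain ⟨t, hx, e, h3⟩ := path_append.1 hp1
  subst e
  obtain ⟨t, hq, e, hr⟩ := path_append.1 h3
  subst e
  have e1 := swap' hc hx (c := c :: q) (d := c :: r ++ x') (y := y' ++ Z) ⟨rfl, hq⟩
    (path_trans (x := c :: r) ⟨rfl, hr⟩ hx') (path_trans hy' hZ)
  obtain ⟨x0, rfl⟩ := head_split hh (ne_nil_of_path hx hpu)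
  obtain ⟨x0', rfl⟩ := head_split hh' (ne_nil_of_path hx' hpu)
  obtain ⟨y0', rfl⟩ := last_split hl' (ne_nil_of_path hy' hpu.symm)
  have hr0 : ∃ r0, r = r0 ++ [a₁] := by
    have h5 : ((a₂ :: x0 ++ c :: q) ++ c :: r).getLast? = some a₁ := by
      rw [← hl]; congr 1; simp
    obtain ⟨r0, hr0⟩ := last_split h5 (by simp)
    cases r0 with
    | nil =>
      simp at hr0
      exact absurd hr0.1 hca
    | cons d r0 =>
      simp at hr0
      exact ⟨r0, hr0.2⟩
  obtain ⟨r0, rfl⟩ := hr0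
  refine ⟨a₂ :: x0 ++ c :: (r0 ++ [a₁]), a₂ :: x0' ++ c :: q ++ (y0' ++ [a₁]), ⟨?_, ?_, ?_⟩,
    ⟨?_, ?_, ?_⟩, ?_, ?_, ?_, ?_⟩
  · exact path_trans hx ⟨rfl, hr⟩
  · simp
  · rw [← List.cons_append, ← List.append_assoc, List.getLast?_concat]
  · exact path_trans (path_trans (y := c :: q) hx' ⟨rfl, hq⟩) hy'
  · simp
  · rw [← List.append_assoc, List.getLast?_concat]
  · simp
  · simp
  · rw [List.perm_iff_count]
    intro d
    simp only [List.count_cons, List.count_append, List.count_nil]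
    omega
  · unfold QuiverData.PathEquiv at *
    simp only [List.append_assoc, List.cons_append, List.nil_append] at *
    exact e1

theorem lemB {c2 : Prop} (hc : c2) {p : Q.V} {c a₁ a₂ : Q.A} (hpu : p ≠ Q.src c) (hca : c ≠ a₁)
    {L₁ L₂ Z : List Q.A}
    (h1 : Lp p a₁ a₂ L₁) (h2 : Lp p a₁ a₂ L₂) (hZ : Q.IsPathFrom p p Z)
    (v1 : Visits p (Q.src c) L₁) (v2 : Visits p (Q.src c) L₂)
    (hcnt : 2 ≤ (L₁ ++ L₂).count c) :
    ∃ M₁ M₂, Lp p a₁ a₂ M₁ ∧ Lp p a₁ a₂ M₂ ∧ c ∈ M₁ ∧ c ∈ M₂ ∧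
      (M₁ ++ M₂).Perm (L₁ ++ L₂) ∧ Q.PathEquiv c2 (L₁ ++ L₂ ++ Z) (M₁ ++ M₂ ++ Z) := by
  by_cases k1 : 2 ≤ L₁.count c
  · exact lemB1 hc hpu hca h1 h2 hZ v2 k1
  by_cases k2 : 2 ≤ L₂.count c
  · obtain ⟨M₁, M₂, m1, m2, m3, m4, m5, m6⟩ := lemB1 hc hpu hca h2 h1 hZ v1 k2
    refine ⟨M₁, M₂, m1, m2, m3, m4, m5.trans List.perm_append_comm, ?_⟩
    have := swap' hc (t := p) (x := []) rfl h1.1 h2.1 hZ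
    exact QuiverData.PEquiv.trans this m6
  · rw [List.count_append] at hcnt
    exact ⟨L₁, L₂, h1, h2, List.count_pos_iff.1 (by omega), List.count_pos_iff.1 (by omega),
      .refl _, .refl _⟩

theorem adeg_eq (l : List Q.A) (c : Q.A) : Q.adeg l c = l.count c := by
  unfold QuiverData.adeg
  induction l with
  | nil => simp
  | cons d t ih =>
    rw [List.count_cons, ← ih, Nat.card_eq_fintype_card, Nat.card_eq_fintype_card,
      Fintype.card_subtype, Fintype.card_subtype]
    simp only [List.length_cons, List.get_eq_getElem]
    rw [Fin.card_filter_univ_succ]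
    simp
    split_ifs <;> simp_all [add_comm]

theorem path_get {u w : Q.V} {l : List Q.A} (h : Q.IsPathFrom u w l) :
    (∀ j (hj : j + 1 < l.length), Q.tgt l[j] = Q.src l[j + 1]) ∧
    (∀ h0 : 0 < l.length, Q.src l[0] = u ∧ Q.tgt l[l.length - 1] = w) := by
  induction l generalizing u with
  | nil => simp
  | cons d t ih =>
    obtain ⟨h1, h2⟩ := h
    obtain ⟨i1, i2⟩ := ih h2
    cases t with
    | nil => simpa [QuiverData.IsPathFrom] using ⟨h1, h2⟩
    | cons e t =>
      refine ⟨?_, fun _ => ⟨h1, ?_⟩⟩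
      · intro j hj
        cases j with
        | zero => exact h2.1.symm
        | succ j => exact i1 j (by simpa using hj)
      · simpa using (i2 (by simp)).2

theorem prim_inj {v : Q.V} {l : List Q.A} (h : Q.IsPrimitiveAt v l) (i j : ℕ) (hi : i < l.length)
    (hj : j < l.length) (e : Q.tgt l[i] = Q.tgt l[j]) : i = j := by
  have := h.2 l[i] (List.getElem_mem _)
  unfold QuiverData.vdeg at this
  obtain ⟨hsub, _⟩ := Nat.card_eq_one_iff_unique.1 this
  have := Subsingleton.elim (α := {k : Fin l.length // Q.tgt (l.get k) = Q.tgt l[i]})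
    ⟨⟨i, hi⟩, rfl⟩ ⟨⟨j, hj⟩, e.symm⟩
  simpa using this

theorem prim_src {v : Q.V} {l : List Q.A} (h : Q.IsPrimitiveAt v l) (hs : 2 ≤ l.length) (j : ℕ)
    (hj : j < l.length) (hj1 : j ≠ 1) : Q.src l[1] ≠ Q.src l[j] := by
  intro e
  obtain ⟨h1, h2⟩ := path_get h.1.2
  have := h1 0 (by omega)
  simp only [zero_add] at this
  cases j with
  | zero =>
    have h3 := h2 (by omega)
    have := prim_inj h 0 (l.length - 1) (by omega) (by omega) (by rw [this, e, h3.1, h3.2])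
    omega
  | succ j =>
    have := prim_inj h 0 j (by omega) (by omega) (by rw [this, e, h1 j hj])
    omega

/-- The critical case: two long loops and a rest visiting `v_k`. -/
theorem critical {c2 : Prop} (hc : c2) {v : Q.V} {al : List Q.A} (hprim : Q.IsPrimitiveAt v al)
    (hnodup : al.Nodup) (hs : 2 ≤ al.length) {L₁ L₂ Z : List Q.A}
    (h1 : Lp (Q.src al[1]) al[0] al[1] L₁) (h2 : Lp (Q.src al[1]) al[0] al[1] L₂)
    (hZ : Q.IsPathFrom (Q.src al[1]) (Q.src al[1]) Z)
    (hcnt : ∀ x ∈ al, 2 ≤ (L₁ ++ L₂ ++ Z).count x)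
    (k : ℕ) (hk : k < al.length) (hk1 : k ≠ 1) (vz : Visits (Q.src al[1]) (Q.src al[k]) Z) :
    Good c2 al[0] al[1] (L₁ ++ L₂ ++ Z) := by
  obtain ⟨ch, -⟩ := path_get hprim.1.2
  have mem0 : ∀ L, Lp (Q.src al[1]) al[0] al[1] L → al[0] ∈ L := by
    intro L hL
    obtain ⟨y, rfl⟩ := last_form hL.2.2
    simp
  have mem1 : ∀ L, Lp (Q.src al[1]) al[0] al[1] L → al[1] ∈ L := by
    intro L hL
    obtain ⟨y, rfl⟩ := head_form hL.2.1
    simp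
  by_cases hk0 : k = 0
  · subst hk0
    exact lemA hc (prim_src hprim hs 0 hk hk1) h1 h2 (visits_src h1.1 (mem0 _ h1))
      (visits_src h2.1 (mem0 _ h2)) vz
  have ind : ∀ j, 2 ≤ j → (hj : j ≤ k) → Good c2 al[0] al[1] (L₁ ++ L₂ ++ Z) ∨
      ∃ M₁ M₂, Lp (Q.src al[1]) al[0] al[1] M₁ ∧ Lp (Q.src al[1]) al[0] al[1] M₂ ∧
        Visits (Q.src al[1]) (Q.src al[j]) M₁ ∧ Visits (Q.src al[1]) (Q.src al[j]) M₂ ∧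
        (M₁ ++ M₂).Perm (L₁ ++ L₂) ∧ Q.PathEquiv c2 (L₁ ++ L₂ ++ Z) (M₁ ++ M₂ ++ Z) := by
    intro j hj2
    induction j, hj2 using Nat.le_induction with
    | base =>
      intro hj
      refine Or.inr ⟨L₁, L₂, h1, h2, ?_, ?_, .refl _, .refl _⟩
      · rw [← ch 1 (by omega)]
        exact visits_tgt h1.1 (mem1 _ h1)
      · rw [← ch 1 (by omega)]
        exact visits_tgt h2.1 (mem1 _ h2)
    | succ j hj2 ih =>
      intro hj
      rcases ih (by omega) with hg | ⟨M₁, M₂, m1, m2, m3, m4, m5, m6⟩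
      · exact Or.inl hg
      have hne := prim_src hprim hs j (by omega) (by omega)
      by_cases hz : al[j] ∈ Z
      · left
        exact (lemA hc hne m1 m2 m3 m4 (visits_src hZ hz)).of_equiv m6
      · right
        have hc2 := hcnt al[j] (List.getElem_mem _)
        rw [List.count_append, List.count_eq_zero.2 hz, ← m5.count_eq] at hc2
        have hj0 : al[j] ≠ al[0] := by
          intro e
          have := (hnodup.getElem_inj_iff).1 e
          omega
        obtain ⟨N₁, N₂, n1, n2, n3, n4, n5, n6⟩ := lemB hc hne hj0 m1 m2 hZ m3 m4 hc2
        refine ⟨N₁, N₂, n1, n2, ?_, ?_, n5.trans m5, m6.trans n6⟩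
        · rw [← ch j (by omega)]
          exact visits_tgt n1.1 n3
        · rw [← ch j (by omega)]
          exact visits_tgt n2.1 n4
  rcases ind k (by omega) le_rfl with hg | ⟨M₁, M₂, m1, m2, m3, m4, m5, m6⟩
  · exact hg
  · exact (lemA hc (prim_src hprim hs k hk hk1) m1 m2 m3 m4 vz).of_equiv m6

theorem main {c2 : Prop} (hc : c2) {v : Q.V} {al : List Q.A} (hprim : Q.IsPrimitiveAt v al)
    (hnodup : al.Nodup) (hs : 2 ≤ al.length) {w₀ : Q.V} {h : List Q.A}
    (hcl : Q.IsClosedAt w₀ h) (hcnt : ∀ x ∈ al, 2 ≤ h.count x)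
    (b : Q.A) (hb : b ∈ h) (hbal : b ∉ al) (hbne : Q.tgt b ≠ Q.src b)
    (k : ℕ) (hk : k < al.length) (hk1 : k ≠ 1)
    (hb1 : Q.tgt b = Q.src al[1] ∨ Q.tgt b = Q.src al[k])
    (hb2 : Q.src b = Q.src al[1] ∨ Q.src b = Q.src al[k]) :
    Good c2 al[0] al[1] h := by
  have hch : Q.tgt al[0] = Q.src al[1] := (path_get hprim.1.2).1 0 (by omega)
  have hne01 : al[1] ≠ al[0] := by
    intro e
    have := (hnodup.getElem_inj_iff).1 e
    omega
  -- rotate `h`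
  have hm : al[1] ∈ h := List.count_pos_iff.1 (by
    have := hcnt al[1] (List.getElem_mem _)
    omega)
  obtain ⟨s, t, rfl, hs1, ht1⟩ := split_at hcl.2 hm
  have e0 : Q.PathEquiv c2 (s ++ al[1] :: t) (al[1] :: t ++ s) := cyc' c2 hs1 ⟨rfl, ht1⟩
  have hp : Q.IsPathFrom (Q.src al[1]) (Q.src al[1]) (al[1] :: t ++ s) :=
    path_trans (x := al[1] :: t) ⟨rfl, ht1⟩ hs1
  have hperm : (s ++ al[1] :: t).Perm (al[1] :: t ++ s) := List.perm_append_comm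
  apply Good.of_equiv _ e0
  replace hcnt : ∀ x ∈ al, 2 ≤ (al[1] :: t ++ s).count x := by
    intro x hx
    rw [← hperm.count_eq]
    exact hcnt x hx
  replace hb := hperm.mem_iff.1 hb
  clear hperm e0 hm hcl
  generalize al[1] :: t ++ s = g at *
  obtain ⟨L, rfl, hL⟩ := fr_decomp (Q.src al[1]) g.length g le_rfl hp
  have hLp : ∀ m ∈ L, Q.IsPathFrom (Q.src al[1]) (Q.src al[1]) m := fun m hm => (hL m hm).2.1
  have c1 := hcnt al[1] (List.getElem_mem _)
  have c0 := hcnt al[0] (List.getElem_mem _)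
  rw [count_src rfl L hL] at c1
  rw [count_tgt hch L hL] at c0
  have eqv : ∀ M : List (List Q.A), L.Perm M → Q.PathEquiv c2 L.flatten M.flatten ∧
      Q.IsPathFrom (Q.src al[1]) (Q.src al[1]) M.flatten := by
    intro M hM
    refine ⟨?_, flat_path M fun l hl => hLp l (hM.mem_iff.2 hl)⟩
    simpa using perm_flatten hc hM [] rfl hLp
  rcases arrange _ _ L c1 c0 with ⟨r, q, r', q', z, hM, k1, k2, k3, k4⟩ |
    ⟨r, l, q, z, hM, k1, k2, k3, k4⟩ | ⟨l, l', z, hM, k1, k2, k3, k4⟩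
  · simp only [decide_eq_true_eq] at k1 k2 k3 k4
    obtain ⟨e1, e2⟩ := eqv _ hM
    refine Good.of_equiv ?_ e1
    obtain ⟨r, rfl⟩ := last_form k1
    obtain ⟨r', rfl⟩ := last_form k3
    obtain ⟨q, rfl⟩ := head_form k2
    obtain ⟨q', rfl⟩ := head_form k4
    have := good_form (c2 := c2) (a₁ := al[0]) (a₂ := al[1]) (p := Q.src al[1]) (X := r)
      (Y := q ++ r') (W := q' ++ z.flatten) (by simpa using e2)
    simpa using this
  · simp only [decide_eq_true_eq] at k1 k2 k3 k4
    obtain ⟨e1, e2⟩ := eqv _ hM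
    refine Good.of_equiv ?_ e1
    obtain ⟨r, rfl⟩ := last_form k1
    obtain ⟨q, rfl⟩ := head_form k4
    obtain ⟨l, rfl⟩ := head_form k2
    have : l ≠ [] := by
      rintro rfl
      simp at k3
      exact hne01 k3
    obtain ⟨l, rfl⟩ := last_split (x := [al[1]]) k3 this
    have := good_form (c2 := c2) (a₁ := al[0]) (a₂ := al[1]) (p := Q.src al[1]) (X := r)
      (Y := l) (W := q ++ z.flatten) (by simpa using e2)
    simpa using this
  · simp only [decide_eq_true_eq] at k1 k2 k3 k4
    obtain ⟨e1, e2⟩ := eqv _ hM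
    refine Good.of_equiv ?_ e1
    have hbl : ∀ m ∈ L, m.head? = some al[1] → m.getLast? = some al[0] → b ∉ m := by
      intro m hm m1 m2 hbm
      obtain ⟨x, y, rfl⟩ := List.append_of_mem hbm
      have hor : Q.src b = Q.src al[1] ∨ Q.tgt b = Q.src al[1] := by
        rcases hb1 with hb1 | hb1
        · exact Or.inr hb1
        · rcases hb2 with hb2 | hb2
          · exact Or.inl hb2
          · exact absurd (hb1.trans hb2.symm) hbne
      rcases hor with h | h
      · have := fr_src (hL _ hm) rfl h
        subst this
        simp at m1
        exact hbal (m1 ▸ List.getElem_mem _)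
      · have := fr_tgt (hL _ hm) rfl h
        subst this
        simp at m2
        exact hbal (m2 ▸ List.getElem_mem _)
    have hl : l ∈ L := hM.mem_iff.2 (by simp)
    have hl' : l' ∈ L := hM.mem_iff.2 (by simp)
    have hzp : Q.IsPathFrom (Q.src al[1]) (Q.src al[1]) z.flatten :=
      flat_path z fun m hm => hLp m (hM.mem_iff.2 (by simp [hm]))
    have hbz : b ∈ z.flatten := by
      have := hM.flatten.mem_iff.1 hb
      simp only [List.flatten_cons, List.mem_append] at this
      rcases this with h | h | h
      · exact absurd h (hbl l hl k1 k2)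
      · exact absurd h (hbl l' hl' k3 k4)
      · exact h
    have vz : Visits (Q.src al[1]) (Q.src al[k]) z.flatten := by
      rcases hb1 with hb1 | hb1
      · rcases hb2 with hb2 | hb2
        · exact absurd (hb1.trans hb2.symm) hbne
        · rw [← hb2]
          exact visits_src hzp hbz
      · rw [← hb1]
        exact visits_tgt hzp hbz
    have := critical hc hprim hnodup hs (L₁ := l) (L₂ := l') (Z := z.flatten)
      ⟨hLp l hl, k1, k2⟩ ⟨hLp l' hl', k3, k4⟩ hzp (by
        intro x hx
        have := hcnt x hx
        rw [hM.flatten.count_eq] at this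
        simpa using this) k hk hk1 vz
    simpa using this

end RIS

/-- **Lemma (repeated initial segment).** Let `char K = 2` and let `a = a₁⋯a_s` be a
primitive closed path in `Q` with `a₁, …, a_s` pairwise different arrows, `s ≥ 2`, and
`vᵢ` the tail of `aᵢ`.  Let `h` be a closed path such that each `aᵢ` occurs at least
twice in `h`, and suppose some arrow `b` occurring in `h` satisfies `b ≠ aᵢ` for all
`i`, its head differs from its tail, and `{head b, tail b} ⊆ {v₂, v_k}` for some
`k ∈ {1, 3, 4, …, s}`.  Then `h ≡ a₁a₂f₁a₁a₂f₂` for some possibly empty paths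
`f₁, f₂`. -/
theorem repeated_initial_segment
    (K : Type) [Field K] [Infinite K] (hchar : ringChar K = 2)
    (Q : QuiverData) (v : Q.V) (al : List Q.A)
    (hprim : Q.IsPrimitiveAt v al) (hnodup : al.Nodup) (hs : 2 ≤ al.length)
    (w₀ : Q.V) (h : List Q.A) (hcl : Q.IsClosedAt w₀ h)
    (htwice : ∀ x ∈ al, 2 ≤ Q.adeg h x)
    (b : Q.A) (hb : b ∈ h) (hbal : b ∉ al) (hbne : Q.tgt b ≠ Q.src b)
    (hk : ∃ k : Fin al.length, (k : ℕ) ≠ 1 ∧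
      Q.tgt b ∈ ({Q.src (al.get ⟨1, by omega⟩), Q.src (al.get k)} : Set Q.V) ∧
      Q.src b ∈ ({Q.src (al.get ⟨1, by omega⟩), Q.src (al.get k)} : Set Q.V)) :
    ∃ f₁ f₂ : List Q.A,
      Q.IsPathFrom (Q.tgt (al.get ⟨1, by omega⟩)) v f₁ ∧
      Q.IsPathFrom (Q.tgt (al.get ⟨1, by omega⟩)) v f₂ ∧
      Q.PathEquiv (ringChar K = 2) h
        (al.get ⟨0, by omega⟩ :: al.get ⟨1, by omega⟩ :: f₁ ++
          al.get ⟨0, by omega⟩ :: al.get ⟨1, by omega⟩ :: f₂) := by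
  obtain ⟨k, hk1, hb1, hb2⟩ := hk
  obtain ⟨f₁, f₂, g1, g2, g3⟩ := RIS.main (c2 := ringChar K = 2) hchar hprim hnodup hs hcl
    (fun x hx => by rw [← RIS.adeg_eq]; exact htwice x hx) b hb hbal hbne k k.2 hk1
    (by simpa using hb1) (by simpa using hb2)
  have hv : Q.src al[0] = v := ((RIS.path_get hprim.1.2).2 (by omega)).1
  rw [hv] at g1 g2
  exact ⟨f₁, f₂, g1, g2, g3⟩
end
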